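/- Consider a quitting game in which the set of normal players I_* is nonempty, enumerated as I_* = {1,…,n}, and suppose that the linear complementarity problem LCP((r̂^i)_{i=1}^n, 0) has no nontrivial solution. If the n×n matrix R̂ whose i-th column is r̂^i is a Q-matrix, then for every ε > 0 the quitting game has a sunspot ε-equilibrium ξ in which at every stage at most one player quits with positive probability, i.e., for every stage t and every signal history (s^1,…,s^t) ∈ [0,1]^t, there is at most one player i with ξ_i^t(s^1,…,s^t) > 0. -/

import Mathlib

open MeasureTheory

noncomputable section

/-- A sunspot strategy of a player: at stage `t` (0-indexed) the player has observed the
`t+1` public signals `s^1,…,s^{t+1}`, and quits with probability `ξ t (s^1,…,s^{t+1})`. -/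
abbrev SunspotStrategy := (t : ℕ) → (Fin (t + 1) → ℝ) → ℝ

/-- A sunspot strategy is valid if every stage-function is Borel measurable with values
in `[0,1]`. -/
def ValidSunspotStrategy (ξ : SunspotStrategy) : Prop :=
  ∀ t : ℕ, Measurable (ξ t) ∧ ∀ s, ξ t s ∈ Set.Icc (0 : ℝ) 1

/-- The product of `t` independent uniform measures on `[0,1]`. -/
def signalMeasure (t : ℕ) : Measure (Fin t → ℝ) :=
  Measure.pi fun _ => volume.restrict (Set.Icc 0 1)

/-- The probability that, under the sunspot strategy profile `ξ`, the game terminates at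
stage `t` (0-indexed) with quitting set `S`. -/
def sunspotTermProb {N : ℕ} (ξ : Fin N → SunspotStrategy) (t : ℕ)
    (S : Finset (Fin N)) : ℝ :=
  ∫ s : Fin (t + 1) → ℝ,
      (∏ u : Fin t, ∏ i : Fin N,
        (1 - ξ i u.1 fun k => s (Fin.castLE (Nat.succ_le_succ u.2.le) k))) *
      ((∏ i ∈ S, ξ i t s) * ∏ i ∈ Sᶜ, (1 - ξ i t s)) ∂(signalMeasure (t + 1))

/-- The collection of nonempty subsets of players. -/
def nonempties (N : ℕ) : Finset (Finset (Fin N)) :=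
  Finset.univ.filter fun S => S ≠ ∅

/-- The expected payoff of player `i` under the sunspot strategy profile `ξ` in the
quitting game with payoffs `r`. -/
def sunspotPayoff {N : ℕ} (r : Finset (Fin N) → Fin N → ℝ)
    (ξ : Fin N → SunspotStrategy) (i : Fin N) : ℝ :=
  (∑' t : ℕ, ∑ S ∈ nonempties N, sunspotTermProb ξ t S * r S i) +
    (1 - ∑' t : ℕ, ∑ S ∈ nonempties N, sunspotTermProb ξ t S) * r ∅ i

/-- `ξ` is a sunspot `ε`-equilibrium: it is a valid profile and no player can gain more
than `ε` by a unilateral deviation to any valid sunspot strategy. -/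
def IsSunspotEpsEquilibrium {N : ℕ} (r : Finset (Fin N) → Fin N → ℝ)
    (ξ : Fin N → SunspotStrategy) (ε : ℝ) : Prop :=
  (∀ i, ValidSunspotStrategy (ξ i)) ∧
    ∀ (i : Fin N) (ξ' : SunspotStrategy), ValidSunspotStrategy ξ' →
      sunspotPayoff r ξ i ≥ sunspotPayoff r (Function.update ξ i ξ') i - ε


/-- The decreasing sequence of sets of players `I_0 ⊇ I_1 ⊇ ⋯`:
`I_0 = I` and `I_{l+1} = {i ∈ I_l : ∃ j ∈ I_l, j ≠ i, r^j_i ≤ 0}`. -/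
def normalLevel {N : ℕ} (r : Finset (Fin N) → Fin N → ℝ) : ℕ → Set (Fin N)
  | 0 => Set.univ
  | l + 1 => {i | i ∈ normalLevel r l ∧ ∃ j ∈ normalLevel r l, j ≠ i ∧ r {j} i ≤ 0}

/-- The set `I_* = ∩_l I_l` of normal players. -/
def normalPlayers {N : ℕ} (r : Finset (Fin N) → Fin N → ℝ) : Set (Fin N) :=
  ⋂ l, normalLevel r l

/-- A solution `(w,z)` of the linear complementarity problem `LCP((r^i)_{i=1}^n, q)`,
where `r i` is the vector `r^i`: `w ∈ ℝ^n_{≥0}`, `z ∈ Δ({0,1,…,n})`,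
`w = z_0 q + ∑_i z_i r^i`, and `z_i = 0` or `w_i = 0` for every `i ∈ [n]`. -/
def IsLCPSolution (n : ℕ) (r : Fin n → Fin n → ℝ) (q w : Fin n → ℝ)
    (z : Fin (n + 1) → ℝ) : Prop :=
  (∀ i, 0 ≤ w i) ∧ (∀ i, 0 ≤ z i) ∧ (∑ i, z i = 1) ∧
    (∀ j, w j = z 0 * q j + ∑ i : Fin n, z i.succ * r i j) ∧
    (∀ i : Fin n, z i.succ = 0 ∨ w i = 0)

/-- The matrix with columns `r^1,…,r^n` is a `Q`-matrix if `LCP((r^i), q)` has a solution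
for every `q ∈ ℝ^n`. -/
def IsQMatrix (n : ℕ) (r : Fin n → Fin n → ℝ) : Prop :=
  ∀ q : Fin n → ℝ, ∃ (w : Fin n → ℝ) (z : Fin (n + 1) → ℝ), IsLCPSolution n r q w z

/-- One-stage weight of the quitting set `S` when player `i` quits with probability `x i`. -/
def stageW {N : ℕ} (x : Fin N → ℝ) (S : Finset (Fin N)) : ℝ :=
  (∏ i ∈ S, x i) * ∏ i ∈ Sᶜ, (1 - x i)

/-- The expected one-stage reward. -/
def stageE {N : ℕ} (x : Fin N → ℝ) (g : Finset (Fin N) → ℝ) (f : ℝ) : ℝ :=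
  (∑ S ∈ nonempties N, stageW x S * g S) + (∏ i, (1 - x i)) * f

lemma stageW_nonneg {N : ℕ} {x : Fin N → ℝ} (hx : ∀ i, x i ∈ Set.Icc (0 : ℝ) 1)
    (S : Finset (Fin N)) : 0 ≤ stageW x S :=
  mul_nonneg (Finset.prod_nonneg fun i _ => (hx i).1)
    (Finset.prod_nonneg fun i _ => by linarith [(hx i).2])

lemma stageW_le_one {N : ℕ} {x : Fin N → ℝ} (hx : ∀ i, x i ∈ Set.Icc (0 : ℝ) 1)
    (S : Finset (Fin N)) : stageW x S ≤ 1 :=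
  mul_le_one₀ (Finset.prod_le_one (fun i _ => (hx i).1) fun i _ => (hx i).2)
    (Finset.prod_nonneg fun i _ => by linarith [(hx i).2])
    (Finset.prod_le_one (fun i _ => by linarith [(hx i).2]) fun i _ => by linarith [(hx i).1])

lemma stageW_empty {N : ℕ} (x : Fin N → ℝ) : stageW x ∅ = ∏ i, (1 - x i) := by
  simp [stageW]

lemma stageW_sum {N : ℕ} (x : Fin N → ℝ) : ∑ S, stageW x S = 1 := by
  have h := Finset.prod_add (fun i => x i) (fun i => 1 - x i) (Finset.univ : Finset (Fin N))
  simp only [add_sub_cancel, Finset.prod_const_one, Finset.powerset_univ] at h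
  rw [h]
  rfl

lemma stageE_eq_sum {N : ℕ} (x : Fin N → ℝ) (g : Finset (Fin N) → ℝ) (f : ℝ) :
    stageE x g f = ∑ S, stageW x S * (if S = ∅ then f else g S) := by
  classical
  have h : (Finset.univ : Finset (Finset (Fin N))) = insert ∅ (nonempties N) := by
    ext S; simp [nonempties, Classical.em]
  rw [h, Finset.sum_insert (by simp [nonempties]), stageE, add_comm]
  congr 1
  · simp [stageW_empty]
  · refine Finset.sum_congr rfl fun S hS => ?_
    have : S ≠ ∅ := by simpa [nonempties] using hS
    simp [this]

lemma stageE_one {N : ℕ} (x : Fin N → ℝ) : stageE x (fun _ => 1) 1 = 1 := by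
  rw [stageE_eq_sum]; simpa using stageW_sum x

/-- survival probability given the first `t` signals -/
def survP {N : ℕ} (ξ : Fin N → SunspotStrategy) (t : ℕ) (s : Fin t → ℝ) : ℝ :=
  ∏ u : Fin t, ∏ i : Fin N, (1 - ξ i u.1 fun k => s (Fin.castLE (Nat.succ_le_of_lt u.2) k))

lemma survP_succ {N : ℕ} (ξ : Fin N → SunspotStrategy) (t : ℕ) (s : Fin (t + 1) → ℝ) :
    survP ξ (t + 1) s = survP ξ t (Fin.init s) * ∏ i, (1 - ξ i t s) := by
  unfold survP
  rw [Fin.prod_univ_castSucc]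
  rfl

lemma termProb_eq {N : ℕ} (ξ : Fin N → SunspotStrategy) (t : ℕ) (S : Finset (Fin N)) :
    sunspotTermProb ξ t S = ∫ s, survP ξ t (Fin.init s) * stageW (fun i => ξ i t s) S
      ∂(signalMeasure (t + 1)) := rfl

instance (t : ℕ) : IsProbabilityMeasure (signalMeasure t) := by
  unfold signalMeasure
  have : IsProbabilityMeasure (volume.restrict (Set.Icc (0 : ℝ) 1)) := ⟨by simp⟩
  infer_instance

lemma meas_init (t : ℕ) : Measurable (fun s : Fin (t + 1) → ℝ => (Fin.init s : Fin t → ℝ)) :=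
  measurable_pi_lambda _ fun _ => measurable_pi_apply _

lemma survP_meas {N : ℕ} {ξ : Fin N → SunspotStrategy} (hξ : ∀ i, ValidSunspotStrategy (ξ i))
    (t : ℕ) : Measurable (survP ξ t) := by
  unfold survP
  refine Finset.measurable_prod _ fun u _ => Finset.measurable_prod _ fun i _ => ?_
  refine measurable_const.sub ((hξ i u.1).1.comp ?_)
  exact measurable_pi_lambda _ fun k => measurable_pi_apply _

lemma survP_mem {N : ℕ} {ξ : Fin N → SunspotStrategy} (hξ : ∀ i, ValidSunspotStrategy (ξ i))
    (t : ℕ) (s : Fin t → ℝ) : survP ξ t s ∈ Set.Icc (0 : ℝ) 1 := by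
  have h0 : ∀ (u : Fin t) (i : Fin N),
      0 ≤ 1 - ξ i u.1 (fun k => s (Fin.castLE (Nat.succ_le_of_lt u.2) k)) :=
    fun u i => by linarith [((hξ i u.1).2 (fun k => s (Fin.castLE (Nat.succ_le_of_lt u.2) k))).2]
  have h1 : ∀ (u : Fin t) (i : Fin N),
      1 - ξ i u.1 (fun k => s (Fin.castLE (Nat.succ_le_of_lt u.2) k)) ≤ 1 :=
    fun u i => by linarith [((hξ i u.1).2 (fun k => s (Fin.castLE (Nat.succ_le_of_lt u.2) k))).1]
  exact ⟨Finset.prod_nonneg fun u _ => Finset.prod_nonneg fun i _ => h0 u i,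
    Finset.prod_le_one (fun u _ => Finset.prod_nonneg fun i _ => h0 u i) fun u _ =>
      Finset.prod_le_one (fun i _ => h0 u i) fun i _ => h1 u i⟩

lemma stageW_meas {N : ℕ} {ξ : Fin N → SunspotStrategy} (hξ : ∀ i, ValidSunspotStrategy (ξ i))
    (t : ℕ) (S : Finset (Fin N)) : Measurable (fun s => stageW (fun i => ξ i t s) S) := by
  unfold stageW
  exact (Finset.measurable_prod _ fun i _ => (hξ i t).1).mul
    (Finset.measurable_prod _ fun i _ => measurable_const.sub (hξ i t).1)

lemma signal_fubini (t : ℕ) (g : (Fin (t + 1) → ℝ) → ℝ) (hg : Measurable g) (B : ℝ)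
    (hB : ∀ s, |g s| ≤ B) :
    ∫ s, g s ∂(signalMeasure (t + 1)) =
      ∫ s, (∫ u in Set.Icc (0 : ℝ) 1, g (Fin.snoc s u)) ∂(signalMeasure t) := by
  have hp := measurePreserving_piFinSuccAbove (α := fun _ : Fin (t + 1) => ℝ)
    (fun _ => volume.restrict (Set.Icc (0 : ℝ) 1)) (Fin.last t)
  have hmeas : Measurable (fun p : ℝ × (Fin t → ℝ) => g (Fin.snoc p.2 p.1)) := by
    refine hg.comp (measurable_pi_lambda _ fun i => ?_)
    refine Fin.lastCases ?_ (fun j => ?_) i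
    · simpa using measurable_fst
    · simp only [Fin.snoc_castSucc]
      exact (measurable_pi_apply j).comp measurable_snd
  have e1 : ∫ s, g s ∂(signalMeasure (t + 1)) =
      ∫ p : ℝ × (Fin t → ℝ), g (Fin.snoc p.2 p.1)
        ∂((volume.restrict (Set.Icc (0 : ℝ) 1)).prod (signalMeasure t)) := by
    have := hp.integral_comp (MeasurableEquiv.measurableEmbedding _)
      (fun p : ℝ × (Fin t → ℝ) => g (Fin.snoc p.2 p.1))
    unfold signalMeasure
    rw [← this]
    refine integral_congr_ae (Filter.Eventually.of_forall fun s => ?_)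
    simp only [MeasurableEquiv.piFinSuccAbove_apply]
    congr 1
    ext i
    refine Fin.lastCases ?_ (fun j => ?_) i
    · simp [Fin.insertNthEquiv]
    · simp [Fin.insertNthEquiv, Fin.init]
  have : IsProbabilityMeasure (volume.restrict (Set.Icc (0 : ℝ) 1)) := ⟨by simp⟩
  rw [e1, integral_prod_symm]
  exact Integrable.of_bound hmeas.aestronglyMeasurable B
    (Filter.Eventually.of_forall fun p => hB _)

lemma super_aux {N : ℕ} {ξ : Fin N → SunspotStrategy} (hξ : ∀ i, ValidSunspotStrategy (ξ i))
    (ρ : Finset (Fin N) → ℝ) (F : (t : ℕ) → (Fin t → ℝ) → ℝ) (hFm : ∀ t, Measurable (F t))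
    (hFb : ∀ t, ∃ B, ∀ s, |F t s| ≤ B)
    (hstep : ∀ t (s : Fin t → ℝ), ∫ u in Set.Icc (0 : ℝ) 1,
      stageE (fun i => ξ i t (Fin.snoc s u)) ρ (F (t + 1) (Fin.snoc s u)) ≤ F t s) (T : ℕ) :
    (∑ t ∈ Finset.range T, ∑ S ∈ nonempties N, sunspotTermProb ξ t S * ρ S) +
      ∫ s, survP ξ T s * F T s ∂(signalMeasure T) ≤ F 0 Fin.elim0 := by
  induction T with
  | zero =>
    have : ∀ s : Fin 0 → ℝ, survP ξ 0 s * F 0 s = F 0 Fin.elim0 := by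
      intro s
      rw [Subsingleton.elim s Fin.elim0]; simp [survP]
    simp only [this]
    simp
  | succ T ih =>
    refine le_trans ?_ ih
    rw [Finset.sum_range_succ, add_assoc]
    refine add_le_add_right ?_ _
    obtain ⟨B, hB⟩ := hFb (T + 1)
    obtain ⟨B', hB'⟩ := hFb T
    have hSm := (survP_meas hξ T).comp (meas_init T)
    have hmem := fun s => survP_mem hξ T s
    have hx : ∀ s i, ξ i T s ∈ Set.Icc (0 : ℝ) 1 := fun s i => (hξ i T).2 s
    have hWb : ∀ s S, |survP ξ T (Fin.init s) * stageW (fun i => ξ i T s) S| ≤ 1 := by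
      intro s S
      rw [abs_of_nonneg (mul_nonneg (hmem _).1 (stageW_nonneg (hx s) S))]
      exact mul_le_one₀ (hmem _).2 (stageW_nonneg (hx s) S) (stageW_le_one (hx s) S)
    have hWi : ∀ S, Integrable (fun s => survP ξ T (Fin.init s) * stageW (fun i => ξ i T s) S)
        (signalMeasure (T + 1)) := fun S =>
      Integrable.of_bound (hSm.mul (stageW_meas hξ T S)).aestronglyMeasurable 1
        (Filter.Eventually.of_forall fun s => hWb s S)
    have hGi : Integrable (fun s => survP ξ (T + 1) s * F (T + 1) s) (signalMeasure (T + 1)) := by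
      refine Integrable.of_bound ((survP_meas hξ _).mul (hFm _)).aestronglyMeasurable B
        (Filter.Eventually.of_forall fun s => ?_)
      rw [Real.norm_eq_abs, abs_mul, abs_of_nonneg (survP_mem hξ _ s).1]
      have := (survP_mem hξ _ s).2
      have h0 := (survP_mem hξ _ s).1
      nlinarith [hB s, abs_nonneg (F (T + 1) s)]
    have hEm : Measurable (fun s => stageE (fun i => ξ i T s) ρ (F (T + 1) s)) := by
      unfold stageE
      refine (Finset.measurable_sum _ fun S _ => (stageW_meas hξ T S).mul_const _).add ?_
      exact (Finset.measurable_prod _ fun i _ => measurable_const.sub (hξ i T).1).mul (hFm _)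
    have hEb : ∀ s, |stageE (fun i => ξ i T s) ρ (F (T + 1) s)| ≤
        (∑ S ∈ nonempties N, |ρ S|) + B := by
      intro s
      unfold stageE
      refine (abs_add_le _ _).trans (add_le_add ?_ ?_)
      · refine (Finset.abs_sum_le_sum_abs _ _).trans (Finset.sum_le_sum fun S _ => ?_)
        rw [abs_mul, abs_of_nonneg (stageW_nonneg (hx s) S)]
        have := stageW_le_one (hx s) S
        nlinarith [abs_nonneg (ρ S)]
      · rw [abs_mul, ← stageW_empty, abs_of_nonneg (stageW_nonneg (hx s) _)]
        have := stageW_le_one (hx s) ∅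
        have := stageW_nonneg (hx s) ∅
        nlinarith [abs_nonneg (F (T + 1) s), hB s]
    have e1 : (∑ S ∈ nonempties N, sunspotTermProb ξ T S * ρ S) +
        ∫ s, survP ξ (T + 1) s * F (T + 1) s ∂(signalMeasure (T + 1)) =
        ∫ s, survP ξ T (Fin.init s) * stageE (fun i => ξ i T s) ρ (F (T + 1) s)
          ∂(signalMeasure (T + 1)) := by
      simp only [termProb_eq, ← integral_mul_const]
      rw [← integral_finsetSum _ (fun S _ => (hWi S).mul_const _),
        ← integral_add (integrable_finsetSum _ fun S _ => (hWi S).mul_const _) hGi]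
      refine integral_congr_ae (Filter.Eventually.of_forall fun s => ?_)
      simp only [stageE, survP_succ, mul_add, Finset.mul_sum, mul_assoc]
    rw [e1, signal_fubini T (fun s => survP ξ T (Fin.init s) *
      stageE (fun i => ξ i T s) ρ (F (T + 1) s)) (hSm.mul hEm) ((∑ S ∈ nonempties N, |ρ S|) + B)]
    · have e2 : ∀ s : Fin T → ℝ, (∫ u in Set.Icc (0 : ℝ) 1,
          survP ξ T (Fin.init (Fin.snoc s u : Fin (T + 1) → ℝ)) *
            stageE (fun i => ξ i T (Fin.snoc s u)) ρ (F (T + 1) (Fin.snoc s u))) =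
          survP ξ T s * ∫ u in Set.Icc (0 : ℝ) 1,
            stageE (fun i => ξ i T (Fin.snoc s u)) ρ (F (T + 1) (Fin.snoc s u)) := by
        intro s
        rw [← integral_const_mul]
        simp only [Fin.init_snoc]
      simp only [e2]
      have hsn : Measurable (fun p : (Fin T → ℝ) × ℝ => (Fin.snoc p.1 p.2 : Fin (T + 1) → ℝ)) := by
        refine measurable_pi_lambda _ fun i => ?_
        refine Fin.lastCases ?_ (fun j => ?_) i
        · simpa using measurable_snd
        · simp only [Fin.snoc_castSucc]
          exact (measurable_pi_apply j).comp measurable_fst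
      refine integral_mono ?_ ?_ fun s => mul_le_mul_of_nonneg_left (hstep T s) (hmem s).1
      · refine Integrable.of_bound ((survP_meas hξ T).aestronglyMeasurable.mul ?_)
          ((∑ S ∈ nonempties N, |ρ S|) + B) (Filter.Eventually.of_forall fun s => ?_)
        · exact ((hEm.comp hsn).stronglyMeasurable.integral_prod_right').aestronglyMeasurable
        · rw [Real.norm_eq_abs, abs_mul, abs_of_nonneg (hmem s).1]
          have h3 : |∫ u in Set.Icc (0 : ℝ) 1,
            stageE (fun i => ξ i T (Fin.snoc s u)) ρ (F (T + 1) (Fin.snoc s u))| ≤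
              (∑ S ∈ nonempties N, |ρ S|) + B := by
            have := norm_setIntegral_le_of_norm_le_const (μ := volume) (s := Set.Icc (0 : ℝ) 1)
              (f := fun u => stageE (fun i => ξ i T (Fin.snoc s u)) ρ (F (T + 1) (Fin.snoc s u)))
              (C := (∑ S ∈ nonempties N, |ρ S|) + B) (by simp) (fun u _ => hEb _)
            simpa using this
          nlinarith [(hmem s).1, (hmem s).2, abs_nonneg (∫ u in Set.Icc (0 : ℝ) 1,
            stageE (fun i => ξ i T (Fin.snoc s u)) ρ (F (T + 1) (Fin.snoc s u)))]
      · refine Integrable.of_bound ((survP_meas hξ T).mul (hFm T)).aestronglyMeasurable B'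
          (Filter.Eventually.of_forall fun s => ?_)
        rw [Real.norm_eq_abs, abs_mul, abs_of_nonneg (hmem s).1]
        nlinarith [(hmem s).1, (hmem s).2, hB' s, abs_nonneg (F T s)]
    · intro s
      rw [abs_mul, abs_of_nonneg (hmem _).1]
      nlinarith [(hmem (Fin.init s)).1, (hmem (Fin.init s)).2, hEb s,
        abs_nonneg (stageE (fun i => ξ i T s) ρ (F (T + 1) s))]

lemma stageE_neg {N : ℕ} (x : Fin N → ℝ) (g : Finset (Fin N) → ℝ) (f : ℝ) :
    stageE x (fun S => - g S) (-f) = - stageE x g f := by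
  simp [stageE, Finset.sum_neg_distrib]; ring

lemma mass_eq {N : ℕ} {ξ : Fin N → SunspotStrategy} (hξ : ∀ i, ValidSunspotStrategy (ξ i))
    (T : ℕ) : (∑ t ∈ Finset.range T, ∑ S ∈ nonempties N, sunspotTermProb ξ t S) +
      ∫ s, survP ξ T s ∂(signalMeasure T) = 1 := by
  have h1 := super_aux hξ (fun _ => 1) (fun _ _ => 1) (fun _ => measurable_const)
    (fun _ => ⟨1, by simp⟩) (fun t s => by simp [stageE_one]) T
  have h2 := super_aux hξ (fun _ => -1) (fun _ _ => -1) (fun _ => measurable_const)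
    (fun _ => ⟨1, by simp⟩) (fun t s => by
      have : ∀ x : Fin N → ℝ, stageE x (fun _ => -1) (-1) = -1 := fun x => by
        rw [stageE_neg x (fun _ => 1) 1, stageE_one]
      simp [this]) T
  simp only [mul_one, mul_neg, Finset.sum_neg_distrib, integral_neg] at h1 h2
  linarith

/-- The payoff of a profile is at most the initial value of a superharmonic potential. -/
lemma payoff_le {N : ℕ} {ξ : Fin N → SunspotStrategy} (hξ : ∀ i, ValidSunspotStrategy (ξ i))
    (ρ : Finset (Fin N) → ℝ) (hρ : ∀ S, |ρ S| ≤ 1)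
    (F : (t : ℕ) → (Fin t → ℝ) → ℝ) (hFm : ∀ t, Measurable (F t))
    (hFb : ∀ t, ∃ B, ∀ s, |F t s| ≤ B)
    (hstep : ∀ t (s : Fin t → ℝ), ∫ u in Set.Icc (0 : ℝ) 1,
      stageE (fun i => ξ i t (Fin.snoc s u)) ρ (F (t + 1) (Fin.snoc s u)) ≤ F t s)
    (hT : ∃ T₀, ∀ t ≥ T₀, ∀ s, ρ ∅ ≤ F t s) :
    (∑' t : ℕ, ∑ S ∈ nonempties N, sunspotTermProb ξ t S * ρ S) +
    (1 - ∑' t : ℕ, ∑ S ∈ nonempties N, sunspotTermProb ξ t S) * ρ ∅ ≤ F 0 Fin.elim0 := by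
  have hnn : ∀ t S, 0 ≤ sunspotTermProb ξ t S := fun t S => by
    rw [termProb_eq]
    exact integral_nonneg fun s => mul_nonneg (survP_mem hξ _ _).1
      (stageW_nonneg (fun i => (hξ i t).2 s) S)
  have hsn : ∀ T, 0 ≤ ∫ s, survP ξ T s ∂(signalMeasure T) := fun T =>
    integral_nonneg fun s => (survP_mem hξ _ _).1
  have hsa : Summable (fun t => ∑ S ∈ nonempties N, sunspotTermProb ξ t S) :=
    summable_of_sum_range_le (fun t => Finset.sum_nonneg fun S _ => hnn t S)
      (c := 1) fun T => by linarith [mass_eq hξ T, hsn T]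
  have hsb : Summable (fun t => ∑ S ∈ nonempties N, sunspotTermProb ξ t S * ρ S) := by
    refine Summable.of_norm_bounded hsa fun t => ?_
    refine (norm_sum_le _ _).trans (Finset.sum_le_sum fun S _ => ?_)
    rw [Real.norm_eq_abs, abs_mul, abs_of_nonneg (hnn t S)]
    exact mul_le_of_le_one_right (hnn t S) (hρ S)
  have ht := (hsb.hasSum.tendsto_sum_nat).add
    (((hsa.hasSum.tendsto_sum_nat).const_sub 1).mul_const (ρ ∅))
  obtain ⟨T₀, hT⟩ := hT
  refine le_of_tendsto ht (Filter.eventually_atTop.2 ⟨T₀, fun T hTT => ?_⟩)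
  refine le_trans ?_ (super_aux hξ ρ F hFm hFb hstep T)
  refine add_le_add_right ?_ _
  have : (1 - ∑ t ∈ Finset.range T, ∑ S ∈ nonempties N, sunspotTermProb ξ t S) =
      ∫ s, survP ξ T s ∂(signalMeasure T) := by linarith [mass_eq hξ T]
  rw [this, ← integral_mul_const]
  obtain ⟨B, hB⟩ := hFb T
  refine integral_mono ?_ ?_ fun s => mul_le_mul_of_nonneg_left (hT T hTT s) (survP_mem hξ _ s).1
  · refine Integrable.of_bound ((survP_meas hξ T).mul_const _).aestronglyMeasurable 1
      (Filter.Eventually.of_forall fun s => ?_)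
    rw [Real.norm_eq_abs, abs_mul, abs_of_nonneg (survP_mem hξ _ s).1]
    exact mul_le_one₀ (survP_mem hξ _ s).2 (abs_nonneg _) (hρ _)
  · refine Integrable.of_bound ((survP_meas hξ T).mul (hFm T)).aestronglyMeasurable B
      (Filter.Eventually.of_forall fun s => ?_)
    rw [Real.norm_eq_abs, abs_mul, abs_of_nonneg (survP_mem hξ _ s).1]
    nlinarith [(survP_mem hξ T s).1, (survP_mem hξ T s).2, hB s, abs_nonneg (F T s)]

instance optFinMeasurableSpace (N : ℕ) : MeasurableSpace (Option (Fin N)) := ⊤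

instance optFinDiscrete (N : ℕ) : DiscreteMeasurableSpace (Option (Fin N)) := ⟨fun _ => trivial⟩

lemma sel_intervalIntegrable {m : ℕ} (g : ℝ → Fin m) (hg : Measurable g) (f : Fin m → ℝ)
    (a b : ℝ) : IntervalIntegrable (fun u => f (g u)) volume a b := by
  have hm : Measurable (fun u => f (g u)) := (measurable_of_finite f).comp hg
  have hb : ∀ u, ‖f (g u)‖ ≤ ∑ i, |f i| := fun u =>
    Finset.single_le_sum (f := fun i => |f i|) (fun i _ => abs_nonneg _) (Finset.mem_univ (g u))
  constructor <;>
  exact Integrable.of_bound hm.aestronglyMeasurable _ (Filter.Eventually.of_forall hb)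

lemma exists_sel_fin (m : ℕ) : ∀ (p : Fin (m + 1) → ℝ) (_ : ∀ i, 0 ≤ p i) (a b : ℝ)
    (_ : ∑ i, p i = b - a), ∃ g : ℝ → Fin (m + 1), Measurable g ∧
      ∀ f : Fin (m + 1) → ℝ, ∫ u in a..b, f (g u) = ∑ i, p i * f i := by
  induction m with
  | zero =>
    intro p hp a b hs
    refine ⟨fun _ => 0, measurable_const, fun f => ?_⟩
    simp at hs
    simp [hs]
  | succ m ih =>
    intro p hp a b hs
    rw [Fin.sum_univ_succ] at hs
    obtain ⟨g, hg, hgf⟩ := ih (fun i => p i.succ) (fun i => hp _) (a + p 0) b (by linarith)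
    have hcb : a + p 0 ≤ b := by
      have : 0 ≤ ∑ i : Fin (m + 1), p i.succ := Finset.sum_nonneg fun i _ => hp _
      linarith
    have hac : a ≤ a + p 0 := by linarith [hp 0]
    have hGm : Measurable (fun u => if u ≤ a + p 0 then (0 : Fin (m + 2)) else (g u).succ) :=
      Measurable.ite measurableSet_Iic measurable_const
        ((measurable_of_finite Fin.succ).comp hg)
    refine ⟨_, hGm, fun f => ?_⟩
    rw [← intervalIntegral.integral_add_adjacent_intervals
      (sel_intervalIntegrable _ hGm f a (a + p 0)) (sel_intervalIntegrable _ hGm f (a + p 0) b),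
      Fin.sum_univ_succ, ← hgf (fun i => f i.succ)]
    congr 1
    · rw [intervalIntegral.integral_congr_uIoo (g := fun _ => f 0)]
      · simp
      · intro u hu
        rw [Set.uIoo_of_le hac] at hu
        simp [hu.2.le]
    · refine intervalIntegral.integral_congr_uIoo fun u hu => ?_
      rw [Set.uIoo_of_le hcb] at hu
      simp [not_le.2 hu.1]

lemma exists_sel {N : ℕ} (p : Option (Fin N) → ℝ) (hp : ∀ a, 0 ≤ p a) (hs : ∑ a, p a = 1) :
    ∃ g : ℝ → Option (Fin N), Measurable g ∧
      ∀ f : Option (Fin N) → ℝ, ∫ u in Set.Icc (0 : ℝ) 1, f (g u) = ∑ a, p a * f a := by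
  have e : Fin (N + 1) ≃ Option (Fin N) := finSuccEquiv N
  obtain ⟨g, hg, hf⟩ := exists_sel_fin N (fun i => p (e i)) (fun i => hp _) 0 1 (by
    rw [e.sum_comp p, hs]; norm_num)
  refine ⟨fun u => e (g u), (measurable_of_finite e).comp hg, fun f => ?_⟩
  rw [integral_Icc_eq_integral_Ioc, ← intervalIntegral.integral_of_le zero_le_one]
  rw [hf (fun i => f (e i)), e.sum_comp (fun a => p a * f a)]

lemma stageE_supp {N : ℕ} (x : Fin N → ℝ) (T : Finset (Fin N)) (hx : ∀ i, i ∉ T → x i = 0)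
    (g : Finset (Fin N) → ℝ) (f : ℝ) :
    stageE x g f = ∑ S ∈ T.powerset, ((∏ i ∈ S, x i) * ∏ i ∈ T \ S, (1 - x i)) *
      (if S = ∅ then f else g S) := by
  classical
  rw [stageE_eq_sum]
  symm
  rw [← Finset.sum_subset (Finset.subset_univ T.powerset)]
  · refine Finset.sum_congr rfl fun S hS => ?_
    congr 2
    refine Finset.prod_subset (fun a ha => ?_) fun a ha hb => ?_
    · simp at ha ⊢; exact ha.2
    · have : x a = 0 := hx a (by simp at ha hb; tauto)
      simp [this]
  · intro S _ hS
    rw [Finset.mem_powerset, Finset.not_subset] at hS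
    obtain ⟨i, hi, hiT⟩ := hS
    simp [stageW, Finset.prod_eq_zero hi (hx i hiT)]

lemma stageE_single {N : ℕ} (x : Fin N → ℝ) (i : Fin N) (hx : ∀ l, l ≠ i → x l = 0)
    (g : Finset (Fin N) → ℝ) (f : ℝ) :
    stageE x g f = x i * g {i} + (1 - x i) * f := by
  classical
  rw [stageE_supp x {i} (by simpa using hx)]
  have : ({i} : Finset (Fin N)).powerset = {∅, {i}} := by ext S; simp [Finset.subset_singleton_iff]
  rw [this, Finset.sum_pair (by simp [eq_comm])]
  simp; ring

lemma stageE_pair {N : ℕ} (x : Fin N → ℝ) (i j : Fin N) (hij : i ≠ j)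
    (hx : ∀ l, l ≠ i → l ≠ j → x l = 0) (g : Finset (Fin N) → ℝ) (f : ℝ) :
    stageE x g f = x i * x j * g {i, j} + x i * (1 - x j) * g {i} + (1 - x i) * x j * g {j}
      + (1 - x i) * (1 - x j) * f := by
  classical
  rw [stageE_supp x {i, j} (by simpa using hx), Finset.sum_powerset_insert (by simpa using hij)]
  have : ({j} : Finset (Fin N)).powerset = {∅, {j}} := by ext S; simp [Finset.subset_singleton_iff]
  rw [this, Finset.sum_pair (by simp [eq_comm]), Finset.sum_pair (by simp [eq_comm])]
  have h1 : ({i, j} : Finset (Fin N)) \ {j} = {i} := by ext a; simp; grind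
  have h2 : ({i, j} : Finset (Fin N)) \ {i} = {j} := by ext a; simp; grind
  simp [h1, h2, Finset.prod_pair hij]
  ring

/-- State process driven by the signals. -/
def stt {N : ℕ} (sel : ℕ → ℝ → Option (Fin N)) (K : ℕ) : (t : ℕ) → (Fin t → ℝ) → ℕ
  | 0, _ => K
  | t + 1, s =>
    if sel (stt sel K t (Fin.init s)) (s (Fin.last t)) = none then stt sel K t (Fin.init s) - 1
    else stt sel K t (Fin.init s)

/-- The strategies: the selected player quits with probability `δ`. -/
def strat {N : ℕ} (sel : ℕ → ℝ → Option (Fin N)) (K : ℕ) (δ : ℝ) (j : Fin N) :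
    SunspotStrategy := fun t s =>
  if sel (stt sel K t (Fin.init s)) (s (Fin.last t)) = some j then δ else 0

lemma sel_state_meas {N : ℕ} {sel : ℕ → ℝ → Option (Fin N)} (hsel : ∀ k, Measurable (sel k))
    {t : ℕ} {f : (Fin t → ℝ) → ℕ} (hf : Measurable f) :
    Measurable (fun s : Fin (t + 1) → ℝ => sel (f (Fin.init s)) (s (Fin.last t))) := by
  have h : Measurable (fun p : ℕ × ℝ => sel p.1 p.2) := measurable_from_prod_countable_right hsel
  exact h.comp ((hf.comp (meas_init t)).prodMk (measurable_pi_apply _))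

lemma stt_meas {N : ℕ} {sel : ℕ → ℝ → Option (Fin N)} (hsel : ∀ k, Measurable (sel k))
    (K : ℕ) : ∀ t, Measurable (stt sel K t) := by
  intro t
  induction t with
  | zero => exact measurable_const
  | succ t ih =>
    refine Measurable.ite ?_ ?_ (ih.comp (meas_init t))
    · exact (sel_state_meas hsel ih) (MeasurableSet.singleton none)
    · exact (measurable_of_countable (fun n : ℕ => n - 1)).comp (ih.comp (meas_init t))

lemma stt_le {N : ℕ} (sel : ℕ → ℝ → Option (Fin N)) (K : ℕ) : ∀ t s, stt sel K t s ≤ K := by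
  intro t
  induction t with
  | zero => intro s; exact le_rfl
  | succ t ih =>
    intro s
    simp only [stt]
    have := ih (Fin.init s)
    split_ifs <;> omega

lemma strat_valid {N : ℕ} {sel : ℕ → ℝ → Option (Fin N)} (hsel : ∀ k, Measurable (sel k))
    (K : ℕ) {δ : ℝ} (hδ : δ ∈ Set.Icc (0 : ℝ) 1) (j : Fin N) :
    ValidSunspotStrategy (strat sel K δ j) := by
  intro t
  constructor
  · refine Measurable.ite ?_ measurable_const measurable_const
    exact (sel_state_meas hsel (stt_meas hsel K t)) (MeasurableSet.singleton (some j))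
  · intro s
    unfold strat
    split_ifs
    · exact hδ
    · simp

lemma stt_snoc {N : ℕ} (sel : ℕ → ℝ → Option (Fin N)) (K t : ℕ) (s : Fin t → ℝ) (u : ℝ) :
    stt sel K (t + 1) (Fin.snoc s u) =
      if sel (stt sel K t s) u = none then stt sel K t s - 1 else stt sel K t s := by
  simp [stt]

lemma strat_snoc {N : ℕ} (sel : ℕ → ℝ → Option (Fin N)) (K t : ℕ) (δ : ℝ) (j : Fin N)
    (s : Fin t → ℝ) (u : ℝ) :
    strat sel K δ j t (Fin.snoc s u) = if sel (stt sel K t s) u = some j then δ else 0 := by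
  simp [strat]

lemma exists_small (K : ℕ) (a : ℕ → ℝ) (ha : ∀ k, 0 < a k) : ∃ θ > 0, ∀ k < K, θ ≤ a k := by
  induction K with
  | zero => exact ⟨1, one_pos, by simp⟩
  | succ K ih =>
    obtain ⟨θ, h0, h⟩ := ih
    refine ⟨min θ (a K), lt_min h0 (ha K), fun k hk => ?_⟩
    rcases Nat.lt_succ_iff_lt_or_eq.1 hk with h1 | h1
    · exact (min_le_left _ _).trans (h k h1)
    · rw [h1]; exact min_le_right _ _

lemma le_sum_range_abs (K : ℕ) (f : ℕ → ℝ) (k : ℕ) (hk : k ≤ K) :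
    |f k| ≤ ∑ l ∈ Finset.range (K + 1), |f l| :=
  Finset.single_le_sum (f := fun l => |f l|) (fun _ _ => abs_nonneg _) (by simp; omega)

lemma integral_le_of_pointwise {N : ℕ} {f : ℝ → ℝ} {g : ℝ → Option (Fin N)} (hg : Measurable g)
    (H : Option (Fin N) → ℝ) (hle : ∀ u, f u ≤ H (g u)) {c : ℝ} (hc : 0 ≤ c)
    (h : ∫ u in Set.Icc (0 : ℝ) 1, H (g u) ≤ c) : ∫ u in Set.Icc (0 : ℝ) 1, f u ≤ c := by
  by_cases hf : IntegrableOn f (Set.Icc (0 : ℝ) 1)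
  · refine le_trans (integral_mono hf ?_ hle) h
    exact Integrable.of_bound ((measurable_of_finite H).comp hg).aestronglyMeasurable
      (∑ i, |H i|) (Filter.Eventually.of_forall fun u =>
        Finset.single_le_sum (f := fun i => |H i|) (fun i _ => abs_nonneg _)
          (Finset.mem_univ (g u)))
  · rw [integral_undef hf]; exact hc

/-- Distribution of the selected player in a state. -/
def selP {N : ℕ} (z : ℕ → Fin N → ℝ) (δ : ℝ) : ℕ → Option (Fin N) → ℝ
  | 0, none => 1
  | 0, some _ => 0
  | k + 1, none => δ / (δ + ∑ j, z k j)
  | k + 1, some j => z k j / (δ + ∑ j, z k j)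

lemma selP_nonneg {N : ℕ} {z : ℕ → Fin N → ℝ} (hz : ∀ k i, 0 ≤ z k i) {δ : ℝ} (hδ : 0 < δ)
    (k : ℕ) (a : Option (Fin N)) : 0 ≤ selP z δ k a := by
  have : ∀ k, 0 ≤ ∑ j, z k j := fun k => Finset.sum_nonneg fun j _ => hz k j
  rcases k with _ | k <;> rcases a with _ | a <;> simp only [selP]
  · norm_num
  · exact le_rfl
  · exact div_nonneg hδ.le (by linarith [this k])
  · exact div_nonneg (hz _ _) (by linarith [this k])

lemma selP_sum {N : ℕ} {z : ℕ → Fin N → ℝ} (hz : ∀ k i, 0 ≤ z k i) {δ : ℝ} (hδ : 0 < δ)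
    (k : ℕ) : ∑ a, selP z δ k a = 1 := by
  have : ∀ k, 0 ≤ ∑ j, z k j := fun k => Finset.sum_nonneg fun j _ => hz k j
  rw [Fintype.sum_option]
  rcases k with _ | k <;> simp only [selP]
  · simp
  · rw [← Finset.sum_div, ← add_div, div_self]
    linarith [this k]

lemma step_upper {N : ℕ} (z : Fin N → ℝ) (hz : ∀ j, 0 ≤ z j) (δ W : ℝ) (hδ : 0 < δ)
    (hW : W = δ + ∑ j, z j) (i : Fin N) (ρ : Fin N → ℝ) (Φ Φ' g g' G : ℝ)
    (hg' : 0 ≤ g') (hstar : Φ ≤ Φ' + ∑ j, z j * (if j = i then 0 else Φ' - ρ j))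
    (hG : δ / W * g + (1 - δ / W) * g' ≤ G) :
    δ / W * (Φ + g) + ∑ j, z j / W * (if j = i then Φ' + g' else δ * ρ j + (1 - δ) * (Φ' + g'))
      ≤ Φ' + G := by
  have hsz : 0 ≤ ∑ j, z j := Finset.sum_nonneg fun j _ => hz j
  have hWp : 0 < W := by linarith
  have h1 : ∑ j, z j / W * (if j = i then Φ' + g' else δ * ρ j + (1 - δ) * (Φ' + g')) ≤
      ∑ j, (z j / W * (Φ' + g') - δ / W * (z j * (if j = i then 0 else Φ' - ρ j))) := by
    refine Finset.sum_le_sum fun j _ => ?_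
    have h2 : 0 ≤ z j / W := div_nonneg (hz j) hWp.le
    have e : δ / W * (z j * (if j = i then 0 else Φ' - ρ j)) =
      z j / W * (δ * (if j = i then 0 else Φ' - ρ j)) := by ring
    rw [e, ← mul_sub]
    refine mul_le_mul_of_nonneg_left ?_ h2
    split_ifs
    · simp
    · nlinarith
  rw [Finset.sum_sub_distrib, ← Finset.mul_sum, ← Finset.sum_mul, ← Finset.sum_div] at h1
  have e2 : (∑ j, z j) / W = 1 - δ / W := by
    rw [hW] at hWp ⊢; field_simp; ring
  rw [e2] at h1
  have h3 : δ / W * Φ ≤ δ / W * (Φ' + ∑ j, z j * (if j = i then 0 else Φ' - ρ j)) :=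
    mul_le_mul_of_nonneg_left hstar (by positivity)
  nlinarith

lemma step_lower {N : ℕ} (z : Fin N → ℝ) (hz : ∀ j, 0 ≤ z j) (δ W : ℝ) (hδ : 0 < δ)
    (hW : W = δ + ∑ j, z j) (ρ : Fin N → ℝ) (Φ Φ' g g' G : ℝ)
    (hg' : 0 ≤ g') (hstar : Φ' + ∑ j, z j * (Φ' - ρ j) ≤ Φ)
    (hG : δ / W * g + (1 - δ / W) * g' ≤ G) :
    Φ' - G ≤ δ / W * (Φ - g) + ∑ j, z j / W * (δ * ρ j + (1 - δ) * (Φ' - g')) := by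
  have hsz : 0 ≤ ∑ j, z j := Finset.sum_nonneg fun j _ => hz j
  have hWp : 0 < W := by linarith
  have h1 : ∑ j, (z j / W * (Φ' - g') - δ / W * (z j * (Φ' - ρ j))) ≤
      ∑ j, z j / W * (δ * ρ j + (1 - δ) * (Φ' - g')) := by
    refine Finset.sum_le_sum fun j _ => ?_
    have h2 : 0 ≤ z j / W := div_nonneg (hz j) hWp.le
    have e : δ / W * (z j * (Φ' - ρ j)) = z j / W * (δ * (Φ' - ρ j)) := by ring
    rw [e, ← mul_sub]
    refine mul_le_mul_of_nonneg_left ?_ h2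
    nlinarith
  rw [Finset.sum_sub_distrib, ← Finset.mul_sum, ← Finset.sum_mul, ← Finset.sum_div] at h1
  have e2 : (∑ j, z j) / W = 1 - δ / W := by
    rw [hW] at hWp ⊢; field_simp; ring
  rw [e2] at h1
  have h3 : δ / W * (Φ' + ∑ j, z j * (Φ' - ρ j)) ≤ δ / W * Φ :=
    mul_le_mul_of_nonneg_left hstar (by positivity)
  nlinarith

lemma G_step (θ lam δ W e t1 : ℝ) (k : ℕ) (hW : 0 < W) (hδ : 0 < δ) (hθ0 : 0 < θ)
    (hθ : θ ≤ δ / (W * (k + 1))) (hlam : lam = 1 + θ) (he : 0 ≤ e) (ht : 0 ≤ t1) :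
    δ / W * (e * (t1 * lam) * (k : ℝ)) + (1 - δ / W) * (e * (t1 * lam) * ((k + 1 : ℕ) : ℝ)) ≤
      e * t1 * ((k + 1 : ℕ) : ℝ) := by
  have hk : (0 : ℝ) < k + 1 := by positivity
  have h1 : θ * (k + 1) ≤ δ / W := by
    rw [le_div_iff₀ (by positivity)] at hθ
    rw [le_div_iff₀ hW]; nlinarith
  have h2 : lam * ((k : ℝ) + 1 - δ / W) ≤ k + 1 := by
    rw [hlam]
    have : 0 ≤ δ / W := by positivity
    nlinarith
  push_cast
  have := mul_le_mul_of_nonneg_left h2 (mul_nonneg he ht)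
  nlinarith

theorem sunspot_of_star {N : ℕ} (r : Finset (Fin N) → Fin N → ℝ)
    (hr : ∀ S i, r S i ∈ Set.Icc (-1 : ℝ) 1) (hdiag : ∀ i : Fin N, r {i} i = 0)
    (ε : ℝ) (hε : 0 < ε) (K : ℕ) (z φ ψ : ℕ → Fin N → ℝ) (hz : ∀ k i, 0 ≤ z k i)
    (hφ : ∀ k i, 0 ≤ φ k i) (hφ0 : ∀ i, 1 ≤ φ 0 i) (hψ0 : ∀ i, ψ 0 i ≤ -1)
    (hup : ∀ k < K, ∀ i,
      φ k i ≤ φ (k + 1) i + ∑ j, z k j * (if j = i then 0 else φ (k + 1) i - r {j} i))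
    (hlo : ∀ k < K, ∀ i, ψ (k + 1) i + ∑ j, z k j * (ψ (k + 1) i - r {j} i) ≤ ψ k i)
    (hK : ∀ i, φ K i - ψ K i ≤ ε / 2) :
    ∃ ξ : Fin N → SunspotStrategy,
      IsSunspotEpsEquilibrium r ξ ε ∧
        ∀ (t : ℕ) (s : Fin (t + 1) → ℝ) (i j : Fin N),
          0 < ξ i t s → 0 < ξ j t s → i = j := by
  obtain ⟨δ, hδ, hδ2, hδε⟩ : ∃ δ : ℝ, 0 < δ ∧ δ ≤ 1 / 2 ∧ 4 * δ ≤ ε / 4 :=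
    ⟨min (1 / 2) (ε / 16), by positivity, min_le_left _ _, by
      linarith [min_le_right (1 / 2) (ε / 16)]⟩
  obtain ⟨e, he, heK⟩ : ∃ e : ℝ, 0 < e ∧ e * K ≤ ε / 8 := by
    refine ⟨ε / (8 * (K + 1)), by positivity, ?_⟩
    rw [div_mul_eq_mul_div, div_le_iff₀ (by positivity)]
    nlinarith
  have hsz : ∀ k, 0 ≤ ∑ j, z k j := fun k => Finset.sum_nonneg fun j _ => hz k j
  have hWp : ∀ k, 0 < δ + ∑ j, z k j := fun k => by linarith [hsz k]
  obtain ⟨θ, hθ0, hθ⟩ := exists_small K (fun k => δ / ((δ + ∑ j, z k j) * (k + 1)))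
    (fun k => div_pos hδ (mul_pos (hWp k) (by positivity)))
  obtain ⟨lam, hlam⟩ : ∃ lam : ℝ, lam = 1 + θ := ⟨_, rfl⟩
  have hlam1 : 1 < lam := by linarith
  choose sel hsel hselI using fun k => exists_sel (selP z δ k) (selP_nonneg hz hδ k) (selP_sum hz hδ k)
  have hδI : δ ∈ Set.Icc (0 : ℝ) 1 := ⟨hδ.le, by linarith⟩
  have hpow : ∀ t : ℕ, 0 < lam ^ t := fun t => pow_pos (by linarith) t
  have hval : ∀ i, ValidSunspotStrategy (strat sel K δ i) := strat_valid hsel K hδI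
  -- measurability / boundedness of functions of the state
  have hmeas : ∀ (f : ℕ → ℕ → ℝ) t, Measurable (fun s => f t (stt sel K t s)) := fun f t =>
    (measurable_of_countable (f t)).comp (stt_meas hsel K t)
  have hbdd : ∀ (f : ℕ → ℕ → ℝ) t, ∃ B, ∀ s, |f t (stt sel K t s)| ≤ B := fun f t =>
    ⟨_, fun s => le_sum_range_abs K (f t) _ (stt_le sel K t s)⟩
  have hbig : ∀ M : ℝ, ∃ T₀ : ℕ, ∀ t ≥ T₀, M ≤ e * lam ^ t := by
    intro M
    obtain ⟨T₀, hT⟩ := pow_unbounded_of_one_lt (M / e) hlam1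
    refine ⟨T₀, fun t ht => ?_⟩
    rw [div_lt_iff₀ he] at hT
    have := pow_le_pow_right₀ hlam1.le ht
    nlinarith
  have hlow : ∀ i, ψ K i - e * K ≤ sunspotPayoff r (strat sel K δ) i := by
    intro i
    have h := payoff_le (ξ := strat sel K δ) hval (fun S => - r S i)
      (fun S => by rw [abs_neg]; exact abs_le.2 (hr S i))
      (fun t s => (fun (t k : ℕ) => -(ψ k i - e * lam ^ t * (k : ℝ))) t (stt sel K t s))
      (hmeas (fun (t k : ℕ) => -(ψ k i - e * lam ^ t * (k : ℝ))))
      (hbdd (fun (t k : ℕ) => -(ψ k i - e * lam ^ t * (k : ℝ)))) ?_ ?_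
    · simp only [mul_neg, Finset.sum_neg_distrib, tsum_neg, stt, pow_zero, mul_one] at h
      unfold sunspotPayoff
      linarith
    · intro t s
      simp only [stt_snoc, strat_snoc]
      obtain ⟨k, hk⟩ : ∃ k, k = stt sel K t s := ⟨_, rfl⟩
      have hkK : k ≤ K := hk ▸ stt_le sel K t s
      rw [← hk]
      have hform : ∀ u, stageE (fun l => if sel k u = some l then δ else 0) (fun S => - r S i)
          (-(ψ (if sel k u = none then k - 1 else k) i - e * lam ^ (t + 1) *
            ((if sel k u = none then k - 1 else k : ℕ) : ℝ))) =
          (fun a : Option (Fin N) => a.elim (-(ψ (k - 1) i - e * lam ^ (t + 1) * ((k - 1 : ℕ) : ℝ)))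
            (fun j => -(δ * r {j} i + (1 - δ) * (ψ k i - e * lam ^ (t + 1) * (k : ℝ)))))
            (sel k u) := by
        intro u
        rw [stageE_neg]
        rcases hu : sel k u with _ | j
        · rw [stageE_single _ i (by simp)]
          simp
        · rw [stageE_single _ j (by simp; intro l hl h; exact absurd h.symm hl)]
          simp
      simp only [hform]
      refine le_of_eq_of_le (hselI k (fun a : Option (Fin N) => a.elim
        (-(ψ (k - 1) i - e * lam ^ (t + 1) * ((k - 1 : ℕ) : ℝ)))
            (fun j => -(δ * r {j} i + (1 - δ) * (ψ k i - e * lam ^ (t + 1) * (k : ℝ)))))) ?_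
      rw [Fintype.sum_option]
      simp only [Option.elim]
      rcases k with _ | k
      · simp [selP]
      · simp only [selP, mul_neg, Finset.sum_neg_distrib, Nat.add_sub_cancel]
        have := step_lower (z k) (hz k) δ _ hδ rfl (fun j => r {j} i) (ψ k i) (ψ (k + 1) i)
          (e * lam ^ (t + 1) * (k : ℝ)) (e * lam ^ (t + 1) * ((k + 1 : ℕ) : ℝ))
          (e * lam ^ t * ((k + 1 : ℕ) : ℝ)) (by have := hpow (t + 1); positivity) (hlo k hkK i)
          (by rw [pow_succ]
              exact G_step θ lam δ _ e _ k (hWp k) hδ hθ0 (hθ k hkK) hlam he.le (hpow t).le)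
        linarith
    · obtain ⟨T₀, hT⟩ := hbig (1 + ∑ l ∈ Finset.range (K + 1), |ψ l i|)
      refine ⟨T₀, fun t ht s => ?_⟩
      have hb := le_sum_range_abs K (fun k => ψ k i) _ (stt_le sel K t s)
      have h1 := (hr ∅ i).1
      rcases hk : stt sel K t s with _ | k
      · simp; linarith [hψ0 i]
      · have h2 := hT t ht
        have h3 := hpow t
        rw [hk] at hb
        have h4 := (abs_le.1 hb).2
        push_cast
        nlinarith [mul_nonneg (mul_nonneg he.le h3.le) (Nat.cast_nonneg (α := ℝ) k)]
  have hupp : ∀ i ξ', ValidSunspotStrategy ξ' →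
      sunspotPayoff r (Function.update (strat sel K δ) i ξ') i ≤ φ K i + 4 * δ + e * K := by
    intro i ξ' hξ'
    have hv : ∀ l, ValidSunspotStrategy (Function.update (strat sel K δ) i ξ' l) := by
      intro l
      by_cases h : l = i
      · subst h; simpa using hξ'
      · simpa [h] using hval l
    have h := payoff_le (ξ := Function.update (strat sel K δ) i ξ') hv (fun S => r S i)
      (fun S => abs_le.2 (hr S i))
      (fun t s => (fun (t k : ℕ) => φ k i + 4 * δ + e * lam ^ t * (k : ℝ)) t (stt sel K t s))
      (hmeas (fun (t k : ℕ) => φ k i + 4 * δ + e * lam ^ t * (k : ℝ)))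
      (hbdd (fun (t k : ℕ) => φ k i + 4 * δ + e * lam ^ t * (k : ℝ))) ?_ ?_
    · simp only [stt, pow_zero, mul_one] at h
      exact h
    · intro t s
      simp only [stt_snoc]
      obtain ⟨k, hk⟩ : ∃ k, k = stt sel K t s := ⟨_, rfl⟩
      have hkK : k ≤ K := hk ▸ stt_le sel K t s
      rw [← hk]
      have hF4 : ∀ k t : ℕ, 4 * δ ≤ φ k i + 4 * δ + e * lam ^ t * (k : ℝ) := fun k t => by
        have := hpow t
        have : 0 ≤ e * lam ^ t * (k : ℝ) := by positivity
        linarith [hφ k i]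
      refine integral_le_of_pointwise (hsel k) (fun a : Option (Fin N) => a.elim
        (φ (k - 1) i + 4 * δ + e * lam ^ (t + 1) * ((k - 1 : ℕ) : ℝ))
        (fun j => if j = i then φ k i + 4 * δ + e * lam ^ (t + 1) * (k : ℝ) else
          δ * r {j} i + (1 - δ) * (φ k i + 4 * δ + e * lam ^ (t + 1) * (k : ℝ)))) ?_
          (by linarith [hF4 k t]) ?_
      · intro u
        have hx := (hξ' t).2 (Fin.snoc s u)
        obtain ⟨x, hxx⟩ : ∃ x, x = ξ' t (Fin.snoc s u) := ⟨_, rfl⟩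
        rw [← hxx] at hx
        have hupd : ∀ l, Function.update (strat sel K δ) i ξ' l t (Fin.snoc s u) =
            if l = i then x else if sel k u = some l then δ else 0 := by
          intro l
          by_cases h : l = i
          · subst h; simp [hxx]
          · simp [h, strat_snoc, hk]
        simp only [hupd]
        rcases hu : sel k u with _ | j
        · rw [stageE_single _ i (by intro l hl; simp [hl])]
          simp only [if_true, Option.elim, hdiag]
          nlinarith [hF4 (k - 1) (t + 1), hx.1, hx.2]
        · by_cases hji : j = i
          · rw [stageE_single _ i (by intro l hl; simp [hl]; rw [hji]; exact fun h => absurd h.symm hl)]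
            simp only [if_true, Option.elim, hdiag, hji, reduceCtorEq, if_false]
            nlinarith [hF4 k (t + 1), hx.1, hx.2]
          · rw [stageE_pair _ i j (Ne.symm hji) (by
              intro l hl hl2; simp [hl]; exact fun h => absurd h.symm hl2)]
            simp only [if_true, Option.elim, hdiag, hji, reduceCtorEq, if_false]
            have h4 := hF4 k (t + 1)
            obtain ⟨Fv, hFv⟩ : ∃ Fv, Fv = φ k i + 4 * δ + e * lam ^ (t + 1) * (k : ℝ) := ⟨_, rfl⟩
            rw [← hFv] at h4 ⊢
            have a1 := (hr {i, j} i).2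
            have a2 := (hr {j} i).1
            have a3 : 0 ≤ x * ((1 - δ) * Fv - δ * (r {i, j} i - r {j} i)) := by
              refine mul_nonneg hx.1 ?_
              nlinarith
            nlinarith
      · refine le_of_eq_of_le (hselI k (fun a : Option (Fin N) => a.elim
          (φ (k - 1) i + 4 * δ + e * lam ^ (t + 1) * ((k - 1 : ℕ) : ℝ))
          (fun j => if j = i then φ k i + 4 * δ + e * lam ^ (t + 1) * (k : ℝ) else
            δ * r {j} i + (1 - δ) * (φ k i + 4 * δ + e * lam ^ (t + 1) * (k : ℝ))))) ?_
        rw [Fintype.sum_option]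
        simp only [Option.elim]
        rcases k with _ | k
        · simp [selP]
        · simp only [selP, Nat.add_sub_cancel]
          refine step_upper (z k) (hz k) δ _ hδ rfl i (fun j => r {j} i) (φ k i + 4 * δ)
            (φ (k + 1) i + 4 * δ)
            (e * lam ^ (t + 1) * (k : ℝ)) (e * lam ^ (t + 1) * ((k + 1 : ℕ) : ℝ))
            (e * lam ^ t * ((k + 1 : ℕ) : ℝ)) (by have := hpow (t + 1); positivity) ?_
            (by rw [pow_succ]
                exact G_step θ lam δ _ e _ k (hWp k) hδ hθ0 (hθ k hkK) hlam he.le (hpow t).le)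
          have h1 := hup k hkK i
          have h2 : ∑ j, z k j * (if j = i then 0 else φ (k + 1) i - r {j} i) ≤
              ∑ j, z k j * (if j = i then 0 else φ (k + 1) i + 4 * δ - r {j} i) := by
            refine Finset.sum_le_sum fun j _ => mul_le_mul_of_nonneg_left ?_ (hz k j)
            split_ifs
            · exact le_rfl
            · linarith
          linarith
    · obtain ⟨T₀, hT⟩ := hbig 1
      refine ⟨T₀, fun t ht s => ?_⟩
      have h1 := (hr ∅ i).2
      rcases hk : stt sel K t s with _ | k
      · simp; linarith [hφ0 i]
      · have h2 := hT t ht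
        have h3 := hpow t
        push_cast
        nlinarith [mul_nonneg (mul_nonneg he.le h3.le) (Nat.cast_nonneg (α := ℝ) k), hφ (k + 1) i]
  refine ⟨strat sel K δ, ⟨hval, fun i ξ' hξ' => ?_⟩, ?_⟩
  · have := hlow i
    have := hupp i ξ' hξ'
    have := hK i
    linarith
  · intro t s i j hi hj
    unfold strat at hi hj
    split_ifs at hi hj with h1 h2
    · rw [h1] at h2; exact Option.some_injective _ h2
    all_goals exact absurd ‹(0 : ℝ) < 0› (lt_irrefl _)
/-- The linear map `z ↦ ∑ j z_j a_j`. -/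
def Am {N : ℕ} (a : Fin N → Fin N → ℝ) (z : Fin N → ℝ) (i : Fin N) : ℝ := ∑ j, z j * a j i

lemma Am_add {N : ℕ} (a : Fin N → Fin N → ℝ) (z w : Fin N → ℝ) (i : Fin N) :
    Am a (fun j => z j + w j) i = Am a z i + Am a w i := by
  simp [Am, add_mul, Finset.sum_add_distrib]

lemma Am_smul {N : ℕ} (a : Fin N → Fin N → ℝ) (t : ℝ) (z : Fin N → ℝ) (i : Fin N) :
    Am a (fun j => t * z j) i = t * Am a z i := by
  simp [Am, Finset.mul_sum, mul_assoc]

lemma Am_zero {N : ℕ} (a : Fin N → Fin N → ℝ) (i : Fin N) : Am a (fun _ => 0) i = 0 := by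
  simp [Am]

lemma Am_abs_le {N : ℕ} {a : Fin N → Fin N → ℝ} (ha : ∀ j i, |a j i| ≤ 1) {z : Fin N → ℝ}
    (hz : ∀ j, 0 ≤ z j) (i : Fin N) : |Am a z i| ≤ ∑ j, z j := by
  refine (Finset.abs_sum_le_sum_abs _ _).trans (Finset.sum_le_sum fun j _ => ?_)
  rw [abs_mul, abs_of_nonneg (hz j)]
  exact mul_le_of_le_one_right (hz j) (ha j i)

lemma Am_continuous {N : ℕ} (a : Fin N → Fin N → ℝ) (i : Fin N) :
    Continuous (fun z : Fin N → ℝ => Am a z i) := by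
  unfold Am; fun_prop

/-- Solutions of the complementarity problem restricted to `J`. -/
def IsSol {N : ℕ} (a : Fin N → Fin N → ℝ) (J : Finset (Fin N)) (d z : Fin N → ℝ) : Prop :=
  (∀ i, 0 ≤ z i) ∧ (∀ i, i ∉ J → z i = 0) ∧
    ∀ i ∈ J, 0 ≤ d i + Am a z i ∧ z i * (d i + Am a z i) = 0

/-- Every complementarity problem on `J` is solvable. -/
def IsQ {N : ℕ} (a : Fin N → Fin N → ℝ) (J : Finset (Fin N)) : Prop :=
  ∀ d, ∃ z, IsSol a J d z

/-- The homogeneous problem on `J` has only the trivial solution. -/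
def IsR0 {N : ℕ} (a : Fin N → Fin N → ℝ) (J : Finset (Fin N)) : Prop :=
  ∀ z, IsSol a J 0 z → ∀ i, z i = 0

/-- Discrete approximate complementarity paths. -/
inductive CPath {N : ℕ} (a : Fin N → Fin N → ℝ) (J : Finset (Fin N)) (Y0 : Fin N → ℝ) :
    (Fin N → ℝ) → ℝ → ℝ → Prop
  | refl : CPath a J Y0 Y0 0 0
  | step {Y : Fin N → ℝ} {p c : ℝ} (z e : Fin N → ℝ) (c' : ℝ) (Y' : Fin N → ℝ)
      (h : CPath a J Y0 Y p c) (hz : ∀ i, 0 ≤ z i) (hzJ : ∀ i, i ∉ J → z i = 0)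
      (he : ∀ i, |e i| ≤ c') (heJ : ∀ i, i ∉ J → e i = 0)
      (hY : ∀ i, Y' i = Y i + e i + Am a z i)
      (hpos : ∀ i ∈ J, 0 ≤ Y' i) (hcomp : ∀ i ∈ J, z i * Y' i = 0) :
      CPath a J Y0 Y' (p + ∑ i, z i) (c + c')

namespace CPath
variable {N : ℕ} {a : Fin N → Fin N → ℝ} {J : Finset (Fin N)} {Y0 Y : Fin N → ℝ} {p c : ℝ}

lemma trans {Y2 : Fin N → ℝ} {p2 c2 : ℝ} (h1 : CPath a J Y0 Y p c) (h2 : CPath a J Y Y2 p2 c2) :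
    CPath a J Y0 Y2 (p + p2) (c + c2) := by
  induction h2 with
  | refl => simpa using h1
  | step z e c' Y' h hz hzJ he heJ hY hpos hcomp ih =>
    have := ih.step z e c' Y' hz hzJ he heJ hY hpos hcomp
    rwa [add_assoc, add_assoc] at this

lemma scale (h : CPath a J Y0 Y p c) {t : ℝ} (ht : 0 < t) :
    CPath a J (fun i => t * Y0 i) (fun i => t * Y i) (t * p) (t * c) := by
  induction h with
  | refl => simpa using CPath.refl
  | step z e c' Y' h hz hzJ he heJ hY hpos hcomp ih =>
    have := ih.step (fun i => t * z i) (fun i => t * e i) (t * c') (fun i => t * Y' i)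
      (fun i => mul_nonneg ht.le (hz i)) (fun i hi => by simp [hzJ i hi])
      (fun i => by rw [abs_mul, abs_of_pos ht]; exact mul_le_mul_of_nonneg_left (he i) ht.le)
      (fun i hi => by simp [heJ i hi]) (fun i => by rw [Am_smul, hY]; ring)
      (fun i hi => mul_nonneg ht.le (hpos i hi))
      (fun i hi => by
        have := hcomp i hi
        calc t * z i * (t * Y' i) = t * t * (z i * Y' i) := by ring
          _ = 0 := by rw [this, mul_zero])
    rwa [← Finset.mul_sum, ← mul_add, ← mul_add] at this

lemma translate (h : CPath a J Y0 Y p c) (D : Fin N → ℝ) (hD : ∀ i ∈ J, D i = 0) :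
    CPath a J (fun i => Y0 i + D i) (fun i => Y i + D i) p c := by
  induction h with
  | refl => exact CPath.refl
  | step z e c' Y' h hz hzJ he heJ hY hpos hcomp ih =>
    exact ih.step z e c' _ hz hzJ he heJ (fun i => by rw [hY]; ring)
      (fun i hi => by simpa [hD i hi] using hpos i hi)
      (fun i hi => by simpa [hD i hi] using hcomp i hi)

lemma cost_nonneg [NeZero N] (h : CPath a J Y0 Y p c) : 0 ≤ p ∧ 0 ≤ c := by
  induction h with
  | refl => simp
  | step z e c' Y' h hz hzJ he heJ hY hpos hcomp ih =>
    have := Finset.sum_nonneg (s := Finset.univ) fun i _ => hz i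
    have h2 := (abs_nonneg _).trans (he 0)
    constructor <;> linarith [ih.1, ih.2]

lemma p_nonneg (h : CPath a J Y0 Y p c) : 0 ≤ p := by
  induction h with
  | refl => simp
  | step z e c' Y' h hz hzJ he heJ hY hpos hcomp ih =>
    have := Finset.sum_nonneg (s := Finset.univ) fun i _ => hz i
    linarith

lemma pos (h : CPath a J Y0 Y p c) (h0 : ∀ i ∈ J, 0 ≤ Y0 i) : ∀ i ∈ J, 0 ≤ Y i := by
  cases h with
  | refl => exact h0
  | step z e c' Y' h hz hzJ he heJ hY hpos hcomp => exact hpos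

lemma abs_le (ha : ∀ j i, |a j i| ≤ 1) (h : CPath a J Y0 Y p c) (i : Fin N) :
    |Y i - Y0 i| ≤ p + c := by
  induction h with
  | refl => simp
  | step z e c' Y' h hz hzJ he heJ hY hpos hcomp ih =>
    have h1 := Am_abs_le ha hz i
    have h2 := he i
    rw [_root_.abs_le] at *
    rw [hY]
    constructor <;> linarith [ih.1, ih.2, h1.1, h1.2, h2.1, h2.2]

lemma abs_le_off (ha : ∀ j i, |a j i| ≤ 1) (h : CPath a J Y0 Y p c) (i : Fin N) (hi : i ∉ J) :
    |Y i - Y0 i| ≤ p := by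
  induction h with
  | refl => simp
  | step z e c' Y' h hz hzJ he heJ hY hpos hcomp ih =>
    have h1 := Am_abs_le ha hz i
    have h2 := heJ i hi
    rw [_root_.abs_le] at *
    rw [hY, h2]
    constructor <;> linarith [ih.1, ih.2, h1.1, h1.2]

lemma perturb (Y0 Y : Fin N → ℝ) {c : ℝ} (hc : ∀ i, |Y i - Y0 i| ≤ c)
    (hJ : ∀ i, i ∉ J → Y i = Y0 i) (hpos : ∀ i ∈ J, 0 ≤ Y i) : CPath a J Y0 Y 0 c := by
  have := (CPath.refl (a := a) (J := J) (Y0 := Y0)).step (fun _ => 0) (fun i => Y i - Y0 i) c Y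
    (fun _ => le_rfl) (fun _ _ => rfl) hc (fun i hi => by simp [hJ i hi])
    (fun i => by rw [Am_zero]; ring) hpos (by simp)
  simpa using this

lemma embed (ha : ∀ j i, |a j i| ≤ 1) {J' : Finset (Fin N)} (hJ : J' ⊆ J) {Z0 Z W : Fin N → ℝ}
    (h : CPath a J' Z0 Z p c) (hW0 : ∀ i ∈ J', W i = 0)
    (hW : ∀ i ∈ J, i ∉ J' → |Z0 i| + p ≤ W i) :
    CPath a J (fun i => W i + Z0 i) (fun i => W i + Z i) p c := by
  induction h with
  | refl => exact CPath.refl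
  | @step Y p c z e c' Y' h hz hzJ he heJ hY hpos hcomp ih =>
    have hs := Finset.sum_nonneg (s := Finset.univ) fun i _ => hz i
    have hp' := CPath.step z e c' Y' h hz hzJ he heJ hY hpos hcomp
    refine (ih fun i hi hi' => by linarith [hW i hi hi']).step z e c' _ hz
      (fun i hi => hzJ i fun h => hi (hJ h)) he
      (fun i hi => heJ i fun h => hi (hJ h)) (fun i => by rw [hY]; ring) ?_ ?_
    · intro i hi
      by_cases hi' : i ∈ J'
      · simpa [hW0 i hi'] using hpos i hi'
      · have h1 := hp'.abs_le_off ha i hi'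
        have h2 := hW i hi hi'
        have h3 := neg_abs_le (Z0 i)
        have := (_root_.abs_le.1 h1).1
        show 0 ≤ W i + Y' i
        linarith
    · intro i hi
      by_cases hi' : i ∈ J'
      · simpa [hW0 i hi'] using hcomp i hi'
      · simp [hzJ i hi']

/-- Linear functionals along a path. -/
lemma functional (h : CPath a J Y0 Y p c) (f : Fin N → ℝ) (hf : ∀ j ∈ J, 1 ≤ ∑ i, f i * a j i) :
    ∑ i, f i * Y0 i + p - c * ∑ i, |f i| ≤ ∑ i, f i * Y i := by
  induction h with
  | refl => simp
  | step z e c' Y' h hz hzJ he heJ hY hpos hcomp ih =>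
    have e2 : ∑ i, f i * Am a z i = ∑ j, z j * ∑ i, f i * a j i := by
      simp only [Am, Finset.mul_sum]
      rw [Finset.sum_comm]
      exact Finset.sum_congr rfl fun i _ => Finset.sum_congr rfl fun j _ => by ring
    have h3 : ∑ j, z j ≤ ∑ j, z j * ∑ i, f i * a j i := by
      refine Finset.sum_le_sum fun j _ => ?_
      by_cases hj : j ∈ J
      · nlinarith [hf j hj, hz j]
      · simp [hzJ j hj]
    have h4 : -(c' * ∑ i, |f i|) ≤ ∑ i, f i * e i := by
      rw [Finset.mul_sum, ← Finset.sum_neg_distrib]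
      refine Finset.sum_le_sum fun i _ => ?_
      have := neg_abs_le (f i * e i)
      rw [abs_mul] at this
      nlinarith [abs_nonneg (f i), he i]
    simp only [hY, mul_add, Finset.sum_add_distrib]
    nlinarith

end CPath
/-- A strictly positive functional on the columns, by Hahn–Banach. -/
lemma exists_functional {N : ℕ} {a : Fin N → Fin N → ℝ} {J : Finset (Fin N)} (hR : IsR0 a J) :
    ∃ f : Fin N → ℝ, (∀ i, i ∉ J → f i = 0) ∧ ∀ j ∈ J, 1 ≤ ∑ i, f i * a j i := by
  classical
  let Δ : Set (Fin N → ℝ) := {z | (∀ i, 0 ≤ z i) ∧ (∀ i, i ∉ J → z i = 0) ∧ ∑ i, z i = 1}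
  let L : (Fin N → ℝ) →ₗ[ℝ] (Fin N → ℝ) :=
    { toFun := fun z i => if i ∈ J then Am a z i else 0
      map_add' := fun z w => by
        ext i
        have := Am_add a z w i
        by_cases h : i ∈ J <;> simp [h]
        exact this
      map_smul' := fun t z => by
        ext i
        have := Am_smul a t z i
        by_cases h : i ∈ J <;> simp [h]
        exact this }
  have hΔc : IsCompact Δ := by
    refine IsCompact.of_isClosed_subset (isCompact_Icc (a := (0 : Fin N → ℝ)) (b := 1)) ?_ ?_
    · refine IsClosed.inter (s₁ := {z : Fin N → ℝ | ∀ i, 0 ≤ z i}) ?_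
        (IsClosed.inter (s₁ := {z : Fin N → ℝ | ∀ i, i ∉ J → z i = 0})
          (s₂ := {z : Fin N → ℝ | ∑ i, z i = 1}) ?_ ?_)
      · simp only [Set.ofPred_forall]
        exact isClosed_iInter fun i => isClosed_le continuous_const (continuous_apply i)
      · simp only [Set.ofPred_forall]
        exact isClosed_iInter fun i => isClosed_iInter fun _ =>
          isClosed_eq (continuous_apply i) continuous_const
      · exact isClosed_eq (by fun_prop) continuous_const
    · rintro z ⟨h1, h2, h3⟩
      refine ⟨h1, fun i => ?_⟩
      show z i ≤ 1
      rw [← h3]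
      exact Finset.single_le_sum (fun i _ => h1 i) (Finset.mem_univ i)
  have hΔx : Convex ℝ Δ := by
    rintro z ⟨h1, h2, h3⟩ w ⟨k1, k2, k3⟩ s t hs ht hst
    refine ⟨fun i => ?_, fun i hi => ?_, ?_⟩
    · exact add_nonneg (mul_nonneg hs (h1 i)) (mul_nonneg ht (k1 i))
    · simp [h2 i hi, k2 i hi]
    · simp only [Pi.add_apply, Pi.smul_apply, smul_eq_mul, Finset.sum_add_distrib,
        ← Finset.mul_sum, h3, k3]
      linarith
  have hLc : Continuous L := L.continuous_of_finiteDimensional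
  have h0 : (0 : Fin N → ℝ) ∉ L '' Δ := by
    rintro ⟨z, ⟨h1, h2, h3⟩, h4⟩
    have : ∀ i, z i = 0 := hR z ⟨h1, h2, fun i hi => by
      have := congrFun h4 i
      simp [L, hi] at this
      simp [this]⟩
    simp [this] at h3
  obtain ⟨f, u, hu, hf⟩ := geometric_hahn_banach_point_closed (hΔx.linear_image L)
    (hΔc.image hLc).isClosed h0
  rw [map_zero] at hu
  refine ⟨fun i => if i ∈ J then f (Pi.single i 1) / u else 0, fun i hi => by simp [hi],
    fun j hj => ?_⟩
  have hjΔ : (Pi.single j 1 : Fin N → ℝ) ∈ Δ := by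
    refine ⟨fun i => ?_, fun i hi => ?_, by simp⟩
    · by_cases h : i = j
      · subst h; simp
      · simp [h]
    · have : i ≠ j := fun h => hi (h ▸ hj)
      simp [this]
  have h1 := hf _ ⟨_, hjΔ, rfl⟩
  have h2 : L (Pi.single j 1) = ∑ i, (if i ∈ J then a j i else 0) • (Pi.single i (1:ℝ) : Fin N → ℝ) := by
    ext i
    rw [Finset.sum_apply]
    simp only [Pi.smul_apply, smul_eq_mul, Pi.single_apply]
    simp [L, Am, Pi.single_apply]
  rw [h2, map_sum] at h1
  simp only [map_smul, smul_eq_mul] at h1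
  have e : ∑ i, (if i ∈ J then f (Pi.single i 1) / u else 0) * a j i =
      (∑ i, (if i ∈ J then a j i else 0) * f (Pi.single i 1)) / u := by
    rw [Finset.sum_div]
    refine Finset.sum_congr rfl fun i _ => ?_
    split_ifs
    · ring
    · simp
  rw [e, le_div_iff₀ hu]
  linarith

lemma exists_small_finset {N : ℕ} (J : Finset (Fin N)) (b : Fin N → ℝ) (hb : ∀ i ∈ J, 0 < b i) :
    ∃ t > 0, ∀ i ∈ J, t ≤ b i := by
  classical
  induction J using Finset.induction_on with
  | empty => exact ⟨1, one_pos, by simp⟩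
  | insert j J hj ih =>
    obtain ⟨t, h0, h⟩ := ih fun i hi => hb i (Finset.mem_insert_of_mem hi)
    refine ⟨min t (b j), lt_min h0 (hb j (Finset.mem_insert_self _ _)), fun i hi => ?_⟩
    rcases Finset.mem_insert.1 hi with rfl | hi
    · exact min_le_right _ _
    · exact (min_le_left _ _).trans (h i hi)

lemma R0_restrict {N : ℕ} {a : Fin N → Fin N → ℝ} (ha : ∀ j i, |a j i| ≤ 1)
    {J J' : Finset (Fin N)} (hJ : J' ⊆ J) (Y : Fin N → ℝ) (hY0 : ∀ i ∈ J', Y i = 0)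
    (hYp : ∀ i ∈ J, i ∉ J' → 0 < Y i) (htriv : ∀ z, IsSol a J Y z → ∀ i, z i = 0) :
    IsR0 a J' := by
  classical
  rintro z ⟨h1, h2, h3⟩ i
  obtain ⟨t, ht, htb⟩ := exists_small_finset (J \ J') (fun i => Y i / (1 + ∑ j, z j))
    (fun i hi => by
      rw [Finset.mem_sdiff] at hi
      exact div_pos (hYp i hi.1 hi.2) (by linarith [Finset.sum_nonneg (s := Finset.univ) fun i _ => h1 i]))
  have hS := Finset.sum_nonneg (s := Finset.univ) fun i _ => h1 i
  have := htriv (fun i => t * z i) ⟨fun i => mul_nonneg ht.le (h1 i),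
    fun i hi => by simp [h2 i fun h => hi (hJ h)], fun i hi => ?_⟩ i
  · exact (mul_eq_zero.1 this).resolve_left ht.ne'
  rw [Am_smul]
  by_cases hi' : i ∈ J'
  · have := h3 i hi'
    rw [Pi.zero_apply, zero_add] at this
    rw [hY0 i hi', zero_add]
    refine ⟨mul_nonneg ht.le this.1, ?_⟩
    calc t * z i * (t * Am a z i) = t * t * (z i * Am a z i) := by ring
      _ = 0 := by rw [this.2, mul_zero]
  · refine ⟨?_, by simp [h2 i hi']⟩
    have h4 := htb i (Finset.mem_sdiff.2 ⟨hi, hi'⟩)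
    rw [le_div_iff₀ (by linarith)] at h4
    have h5 := (abs_le.1 (Am_abs_le ha h1 i)).1
    nlinarith

/-- Solutions of nearby problems are small. -/
lemma small_solutions {N : ℕ} {a : Fin N → Fin N → ℝ} {J : Finset (Fin N)} (hR : IsR0 a J)
    (Y d : Fin N → ℝ) (htriv : ∀ z, IsSol a J Y z → ∀ i, z i = 0) (ρ : ℝ) (hρ : 0 < ρ) :
    ∃ S > 0, ∀ s, 0 < s → s ≤ S → ∀ z, IsSol a J (fun i => Y i + s * d i) z → ∑ i, z i < ρ := by
  by_contra hcon
  push Not at hcon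
  have hn : ∀ n : ℕ, ∃ s z, 0 < s ∧ s ≤ 1 / ((n : ℝ) + 1) ∧
      IsSol a J (fun i => Y i + s * d i) z ∧ ρ ≤ ∑ i, z i := by
    intro n
    obtain ⟨s, h1, h2, z, h3, h4⟩ := hcon (1 / ((n : ℝ) + 1)) (by positivity)
    exact ⟨s, z, h1, h2, h3, h4⟩
  choose s z hs0 hs1 hsol hbig using hn
  have hst : Filter.Tendsto s Filter.atTop (nhds 0) :=
    tendsto_of_tendsto_of_tendsto_of_le_of_le tendsto_const_nhds
      tendsto_one_div_add_atTop_nhds_zero_nat (fun n => (hs0 n).le) hs1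
  have hSp : ∀ n, 0 < 1 + ∑ i, z n i := fun n => by linarith [hbig n]
  let w : ℕ → Fin N → ℝ := fun n i => (1 + ∑ i, z n i)⁻¹ * z n i
  have hwsum : ∀ n, 1 - ∑ i, w n i = (1 + ∑ i, z n i)⁻¹ := fun n => by
    simp only [w, ← Finset.mul_sum]
    have := (hSp n).ne'
    field_simp
    ring
  have hw0 : ∀ n i, 0 ≤ w n i := fun n i => mul_nonneg (inv_nonneg.2 (hSp n).le) ((hsol n).1 i)
  have hwI : ∀ n, w n ∈ Set.Icc (0 : Fin N → ℝ) 1 := fun n => by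
    refine ⟨fun i => hw0 n i, fun i => ?_⟩
    have h1 := Finset.single_le_sum (fun i _ => hw0 n i) (Finset.mem_univ i)
    have h2 := hwsum n
    have h3 := inv_nonneg.2 (hSp n).le
    show w n i ≤ 1
    linarith
  obtain ⟨v, hv, g, hg, hlim⟩ := isCompact_Icc.tendsto_subseq hwI
  have hlimi : ∀ i, Filter.Tendsto (fun n => w (g n) i) Filter.atTop (nhds (v i)) := fun i =>
    (continuous_apply i).continuousAt.tendsto.comp hlim
  have hsg := hst.comp hg.tendsto_atTop
  have hτ : Filter.Tendsto (fun n => 1 - ∑ i, w (g n) i) Filter.atTop (nhds (1 - ∑ i, v i)) :=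
    tendsto_const_nhds.sub (tendsto_finsetSum _ fun i _ => hlimi i)
  have hE : ∀ i, Filter.Tendsto (fun n => (1 - ∑ i, w (g n) i) * (Y i + s (g n) * d i) +
      Am a (w (g n)) i) Filter.atTop (nhds ((1 - ∑ i, v i) * (Y i + 0 * d i) + Am a v i)) :=
    fun i => (hτ.mul (tendsto_const_nhds.add (hsg.mul tendsto_const_nhds))).add
      ((Am_continuous a i).continuousAt.tendsto.comp hlim)
  have hEn : ∀ n i, (1 - ∑ i, w n i) * (Y i + s n * d i) + Am a (w n) i =
      (1 + ∑ i, z n i)⁻¹ * (Y i + s n * d i + Am a (z n) i) := fun n i => by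
    rw [hwsum, Am_smul]; ring
  have c1 : ∀ i, 0 ≤ v i := fun i => hv.1 i
  have c2 : ∀ i, i ∉ J → v i = 0 := fun i hi => by
    refine tendsto_nhds_unique (hlimi i) ?_
    have : ∀ n, w (g n) i = 0 := fun n => by simp [w, (hsol (g n)).2.1 i hi]
    simp [this]
  have c3 : ∀ i ∈ J, 0 ≤ (1 - ∑ i, v i) * Y i + Am a v i := fun i hi => by
    have := ge_of_tendsto (hE i) (b := 0) (Filter.Eventually.of_forall fun n => by
      rw [hEn]
      exact mul_nonneg (inv_nonneg.2 (hSp _).le) ((hsol (g n)).2.2 i hi).1)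
    simpa using this
  have c4 : ∀ i ∈ J, v i * ((1 - ∑ i, v i) * Y i + Am a v i) = 0 := fun i hi => by
    have h1 := (hlimi i).mul (hE i)
    have : ∀ n, w (g n) i * ((1 - ∑ i, w (g n) i) * (Y i + s (g n) * d i) +
      Am a (w (g n)) i) = 0 := fun n => by
      rw [hEn]
      have h2 := ((hsol (g n)).2.2 i hi).2
      simp only [w]
      calc _ = (1 + ∑ i, z (g n) i)⁻¹ * (1 + ∑ i, z (g n) i)⁻¹ *
          (z (g n) i * (Y i + s (g n) * d i + Am a (z (g n)) i)) := by ring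
        _ = 0 := by rw [h2, mul_zero]
    simp only [this] at h1
    have := tendsto_nhds_unique h1 tendsto_const_nhds
    simpa using this
  have c5 : 0 ≤ 1 - ∑ i, v i := ge_of_tendsto hτ (Filter.Eventually.of_forall fun n => by
    rw [hwsum]; exact inv_nonneg.2 (hSp _).le)
  have c6 : 1 - ∑ i, v i ≤ (1 + ρ)⁻¹ := le_of_tendsto hτ (Filter.Eventually.of_forall fun n => by
    rw [hwsum]
    exact inv_anti₀ (by linarith) (by linarith [hbig (g n)]))
  have c7 : (1 + ρ)⁻¹ < 1 := inv_lt_one_of_one_lt₀ (by linarith)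
  have hv0 : ∀ i, v i = 0 := by
    rcases c5.eq_or_lt with h | h
    · refine hR v ⟨c1, c2, fun i hi => ?_⟩
      have h3 := c3 i hi
      have h4 := c4 i hi
      rw [← h, zero_mul] at h3 h4
      exact ⟨h3, h4⟩
    · have := htriv (fun i => (1 - ∑ i, v i)⁻¹ * v i) ⟨fun i => mul_nonneg (inv_nonneg.2 h.le) (c1 i),
        fun i hi => by simp [c2 i hi], fun i hi => ?_⟩
      · intro i
        exact (mul_eq_zero.1 (this i)).resolve_left (inv_ne_zero h.ne')
      · rw [Am_smul]
        obtain ⟨τ, hτe⟩ : ∃ τ, τ = 1 - ∑ i, v i := ⟨_, rfl⟩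
        have h3 := c3 i hi
        have h4 := c4 i hi
        rw [← hτe] at h h3 h4 ⊢
        have e : Y i + τ⁻¹ * Am a v i = τ⁻¹ * (τ * Y i + Am a v i) := by
          field_simp
        rw [e]
        refine ⟨mul_nonneg (inv_nonneg.2 h.le) h3, ?_⟩
        calc _ = τ⁻¹ * τ⁻¹ * (v i * (τ * Y i + Am a v i)) := by ring
          _ = 0 := by rw [h4, mul_zero]
  simp [hv0] at c6
  linarith

lemma Q_restrict {N : ℕ} {a : Fin N → Fin N → ℝ} (ha : ∀ j i, |a j i| ≤ 1)
    {J J' : Finset (Fin N)} (hJ : J' ⊆ J) (hR : IsR0 a J) (hQ : IsQ a J)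
    (Y : Fin N → ℝ) (hY0 : ∀ i ∈ J', Y i = 0)
    (hYp : ∀ i ∈ J, i ∉ J' → 0 < Y i) (htriv : ∀ z, IsSol a J Y z → ∀ i, z i = 0) :
    IsQ a J' := by
  classical
  intro d
  obtain ⟨t, ht, htb⟩ := exists_small_finset (J \ J') Y (fun i hi => by
      rw [Finset.mem_sdiff] at hi
      exact hYp i hi.1 hi.2)
  obtain ⟨S, hS, hSs⟩ := small_solutions hR Y d htriv (t / 2) (by positivity)
  have hD : 0 ≤ ∑ i, |d i| := Finset.sum_nonneg fun i _ => abs_nonneg _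
  obtain ⟨s, hs0, hs1, hs2⟩ : ∃ s, 0 < s ∧ s ≤ S ∧ s * (∑ i, |d i|) ≤ t / 2 := by
    refine ⟨min S (t / 2 / (1 + ∑ i, |d i|)), lt_min hS (by positivity), min_le_left _ _, ?_⟩
    have := min_le_right S (t / 2 / (1 + ∑ i, |d i|))
    rw [le_div_iff₀ (by linarith)] at this
    have h2 : 0 < min S (t / 2 / (1 + ∑ i, |d i|)) := lt_min hS (by positivity)
    nlinarith
  obtain ⟨z, hz⟩ := hQ (fun i => Y i + s * d i)
  have hzs := hSs s hs0 hs1 z hz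
  obtain ⟨h1, h2, h3⟩ := hz
  have hz' : ∀ i, i ∉ J' → z i = 0 := by
    intro i hi'
    by_cases hi : i ∈ J
    · have h4 := htb i (Finset.mem_sdiff.2 ⟨hi, hi'⟩)
      have h5 := (abs_le.1 (Am_abs_le ha h1 i)).1
      have h6 : |d i| ≤ ∑ i, |d i| :=
        Finset.single_le_sum (f := fun i => |d i|) (fun i _ => abs_nonneg _) (Finset.mem_univ i)
      have h7 := neg_abs_le (d i)
      refine (mul_eq_zero.1 (h3 i hi).2).resolve_right (ne_of_gt ?_)
      nlinarith
    · exact h2 i hi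
  refine ⟨fun i => s⁻¹ * z i, fun i => mul_nonneg (inv_nonneg.2 hs0.le) (h1 i),
    fun i hi => by simp [hz' i hi], fun i hi => ?_⟩
  have h4 := h3 i (hJ hi)
  simp only [hY0 i hi, zero_add] at h4
  have e : d i + Am a (fun i => s⁻¹ * z i) i = s⁻¹ * (s * d i + Am a z i) := by
    rw [Am_smul]; field_simp
  rw [e]
  refine ⟨mul_nonneg (inv_nonneg.2 hs0.le) h4.1, ?_⟩
  calc _ = s⁻¹ * s⁻¹ * (z i * (s * d i + Am a z i)) := by ring
    _ = 0 := by rw [h4.2, mul_zero]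
/-- From `Y` a path can advance by at least `σ` at relative cost `κ`. -/
def Adv {N : ℕ} (a : Fin N → Fin N → ℝ) (J : Finset (Fin N)) (Y : Fin N → ℝ) (σ κ : ℝ) : Prop :=
  ∃ Y' p c, CPath a J Y Y' p c ∧ σ ≤ p ∧ c ≤ κ * p ∧ ∃ i ∈ J, Y' i = 0

/-- Existence of cheap unit-length paths on `J` starting near zero. -/
def PClaim {N : ℕ} (a : Fin N → Fin N → ℝ) (J : Finset (Fin N)) : Prop :=
  ∀ κ > 0, ∃ Y0 Y c, CPath a J Y0 Y 1 c ∧ c ≤ κ ∧ (∀ i, 0 ≤ Y0 i ∧ Y0 i ≤ κ) ∧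
    (∀ i, i ∉ J → Y0 i = 0) ∧ ∃ i ∈ J, Y i = 0

lemma Adv.near {N : ℕ} {a : Fin N → Fin N → ℝ} {J : Finset (Fin N)} {Y Y1 : Fin N → ℝ} {σ κ : ℝ}
    (hκ : 0 < κ) (h : Adv a J Y σ (κ / 2)) (h1 : ∀ i, |Y i - Y1 i| ≤ κ / 2 * σ)
    (hJ : ∀ i, i ∉ J → Y i = Y1 i) (hpos : ∀ i ∈ J, 0 ≤ Y i) : Adv a J Y1 σ κ := by
  obtain ⟨Y', p, c, hp, hσ, hc, hz⟩ := h
  refine ⟨Y', _, _, (CPath.perturb Y1 Y h1 hJ hpos).trans hp, by linarith, ?_, hz⟩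
  nlinarith

lemma Adv.translate {N : ℕ} {a : Fin N → Fin N → ℝ} {J : Finset (Fin N)} {Y Y1 : Fin N → ℝ}
    {σ κ : ℝ} (h : Adv a J Y σ κ) (h1 : ∀ i ∈ J, Y1 i = Y i) : Adv a J Y1 σ κ := by
  obtain ⟨Y', p, c, hp, hσ, hc, i, hi, hz⟩ := h
  have h2 := hp.translate (fun i => Y1 i - Y i) (fun i hi => by simp [h1 i hi])
  have e : (fun i => Y i + (Y1 i - Y i)) = Y1 := by ext i; ring
  rw [e] at h2
  exact ⟨_, p, c, h2, hσ, hc, i, hi, by simp [hz, h1 i hi]⟩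

lemma local_adv {N : ℕ} {a : Fin N → Fin N → ℝ} (ha : ∀ j i, |a j i| ≤ 1)
    {J : Finset (Fin N)} (hR : IsR0 a J) (hQ : IsQ a J)
    (IH : ∀ J', J' ⊂ J → J'.Nonempty → IsR0 a J' → IsQ a J' → PClaim a J')
    (Y : Fin N → ℝ) (hY : ∀ i, 0 ≤ Y i) (h0 : ∃ i ∈ J, Y i = 0)
    (hp : ∃ i ∈ J, 0 < Y i) (κ : ℝ) (hκ : 0 < κ) : ∃ σ > 0, Adv a J Y σ κ := by
  classical
  by_cases htriv : ∀ z, IsSol a J Y z → ∀ i, z i = 0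
  · let J' := J.filter fun i => Y i = 0
    have hJ : J' ⊆ J := Finset.filter_subset _ _
    have hY0 : ∀ i ∈ J', Y i = 0 := fun i hi => (Finset.mem_filter.1 hi).2
    have hYp : ∀ i ∈ J, i ∉ J' → 0 < Y i := fun i hi hi' =>
      lt_of_le_of_ne (hY i) fun h => hi' (Finset.mem_filter.2 ⟨hi, h.symm⟩)
    have hss : J' ⊂ J := by
      refine Finset.ssubset_iff_subset_ne.2 ⟨hJ, fun h => ?_⟩
      obtain ⟨i, hi, hi2⟩ := hp
      rw [← h] at hi
      linarith [hY0 i hi]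
    have hne : J'.Nonempty := by
      obtain ⟨i, hi, hi2⟩ := h0
      exact ⟨i, Finset.mem_filter.2 ⟨hi, hi2⟩⟩
    obtain ⟨Z0, Z, c, hpath, hc, hZ0, hZoff, i0, hi0, hZi⟩ := IH J' hss hne
      (R0_restrict ha hJ Y hY0 hYp htriv) (Q_restrict ha hJ hR hQ Y hY0 hYp htriv) (κ / 2)
      (by positivity)
    obtain ⟨σ, hσ, hσb⟩ := exists_small_finset (J \ J') Y (fun i hi => by
      rw [Finset.mem_sdiff] at hi
      exact hYp i hi.1 hi.2)
    refine ⟨σ, hσ, ?_⟩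
    have h1 := (hpath.scale hσ).embed ha hJ (W := Y) hY0 (fun i hi hi' => by
      have := hσb i (Finset.mem_sdiff.2 ⟨hi, hi'⟩)
      simpa [hZoff i hi'] using this)
    have h2 : CPath a J Y (fun i => Y i + σ * Z0 i) 0 (σ * (κ / 2)) := by
      refine CPath.perturb _ _ (fun i => ?_) (fun i hi => ?_) (fun i hi => ?_)
      · rw [add_sub_cancel_left, abs_of_nonneg (mul_nonneg hσ.le (hZ0 i).1)]
        exact mul_le_mul_of_nonneg_left (hZ0 i).2 hσ.le
      · simp [hZoff i fun h => hi (hJ h)]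
      · exact add_nonneg (hY i) (mul_nonneg hσ.le (hZ0 i).1)
    refine ⟨_, _, _, h2.trans h1, by linarith, ?_, i0, hJ hi0, by simp [hZi, hY0 i0 hi0]⟩
    nlinarith
  · push Not at htriv
    obtain ⟨z, ⟨h1, h2, h3⟩, i, hi⟩ := htriv
    have hzi : 0 < z i := lt_of_le_of_ne (h1 i) (Ne.symm hi)
    have hs : 0 < ∑ i, z i := Finset.sum_pos' (fun i _ => h1 i) ⟨i, Finset.mem_univ _, hzi⟩
    have hiJ : i ∈ J := by by_contra h; exact hi (h2 i h)
    refine ⟨∑ i, z i, hs, _, _, _, (CPath.refl (a := a) (J := J) (Y0 := Y)).step z (fun _ => 0) 0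
      (fun i => Y i + Am a z i) h1 h2 (by simp) (by simp) (by simp) (fun i hi => (h3 i hi).1)
      (fun i hi => (h3 i hi).2), by simp, ?_, i, hiJ, ?_⟩
    · simp; positivity
    · exact (mul_eq_zero.1 (h3 i hiJ).2).resolve_left hi

lemma uniform_adv {N : ℕ} {a : Fin N → Fin N → ℝ} {J : Finset (Fin N)}
    (C : Set (Fin N → ℝ)) (hC : IsCompact C) (hpos : ∀ Y ∈ C, ∀ i, 0 ≤ Y i)
    (hoff : ∀ Y ∈ C, ∀ i, i ∉ J → Y i = 0)
    (hloc : ∀ Y ∈ C, ∀ κ > 0, ∃ σ > 0, Adv a J Y σ κ) (κ : ℝ) (hκ : 0 < κ) :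
    ∃ σ > 0, ∀ Y ∈ C, Adv a J Y σ κ := by
  have hmono : ∀ Y σ σ', σ' ≤ σ → Adv a J Y σ κ → Adv a J Y σ' κ := by
    rintro Y σ σ' h ⟨Y', p, c, h1, h2, h3⟩
    exact ⟨Y', p, c, h1, h.trans h2, h3⟩
  have := hC.induction_on (p := fun S => ∃ σ > 0, ∀ Y ∈ S, Y ∈ C → Adv a J Y σ κ)
    ⟨1, one_pos, by simp⟩
    (fun S T hST ⟨σ, h1, h2⟩ => ⟨σ, h1, fun Y hY => h2 Y (hST hY)⟩)
    (fun S T ⟨σ, h1, h2⟩ ⟨σ', h1', h2'⟩ => ⟨min σ σ', lt_min h1 h1', fun Y hY hYC => by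
      rcases hY with hY | hY
      · exact hmono Y _ _ (min_le_left _ _) (h2 Y hY hYC)
      · exact hmono Y _ _ (min_le_right _ _) (h2' Y hY hYC)⟩)
    (fun Y hY => by
      obtain ⟨σ, hσ, h⟩ := hloc Y hY (κ / 2) (by positivity)
      refine ⟨Metric.ball Y (κ / 2 * σ), mem_nhdsWithin_of_mem_nhds
        (Metric.ball_mem_nhds _ (by positivity)), σ, hσ, fun Y1 hY1 hY1C => ?_⟩
      refine h.near hκ (fun i => ?_) (fun i hi => by rw [hoff Y hY i hi, hoff Y1 hY1C i hi])
        (fun i _ => hpos Y hY i)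
      have h1 := dist_le_pi_dist Y1 Y i
      rw [Metric.mem_ball] at hY1
      rw [Real.dist_eq, abs_sub_comm] at h1
      linarith)
  obtain ⟨σ, h1, h2⟩ := this
  exact ⟨σ, h1, fun Y hY => h2 Y hY hY⟩

theorem pclaim {N : ℕ} {a : Fin N → Fin N → ℝ} (ha : ∀ j i, |a j i| ≤ 1)
    (hdiag : ∀ i, a i i = 0) (J : Finset (Fin N)) :
    J.Nonempty → IsR0 a J → IsQ a J → PClaim a J := by
  classical
  induction J using Finset.strongInduction with
  | H J IH =>
  intro hne hR hQ κ hκ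
  obtain ⟨f, hfoff, hf⟩ := exists_functional hR
  -- a coordinate with positive weight
  obtain ⟨j, hj, hfj⟩ : ∃ j ∈ J, 0 < f j := by
    by_contra hcon
    push Not at hcon
    obtain ⟨z, h1, h2, h3⟩ := hQ (fun _ => -1)
    have hA : ∀ i ∈ J, 1 ≤ Am a z i := fun i hi => by linarith [(h3 i hi).1]
    obtain ⟨i, hi⟩ := hne
    have hzs : 1 ≤ ∑ i, z i := (hA i hi).trans ((le_abs_self _).trans (Am_abs_le ha h1 i))
    have e2 : ∑ i, f i * Am a z i = ∑ j, z j * ∑ i, f i * a j i := by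
      simp only [Am, Finset.mul_sum]
      rw [Finset.sum_comm]
      exact Finset.sum_congr rfl fun i _ => Finset.sum_congr rfl fun j _ => by ring
    have h4 : ∑ j, z j ≤ ∑ j, z j * ∑ i, f i * a j i := by
      refine Finset.sum_le_sum fun j _ => ?_
      by_cases hj : j ∈ J
      · nlinarith [hf j hj, h1 j]
      · simp [h2 j hj]
    have h5 : ∑ i, f i * Am a z i ≤ 0 := by
      refine Finset.sum_nonpos fun i _ => ?_
      by_cases hi : i ∈ J
      · nlinarith [hcon i hi, hA i hi]
      · simp [hfoff i hi]
    linarith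
  -- a second coordinate
  obtain ⟨j', hj', hjj⟩ : ∃ j' ∈ J, j' ≠ j := by
    by_contra hcon
    push Not at hcon
    have := hR (Pi.single j 1) ⟨fun i => by by_cases h : i = j <;> [(subst h; simp); simp [h]],
      fun i hi => by
        have : i ≠ j := fun h => hi (h ▸ hj)
        simp [this], fun i hi => by
        rw [hcon i hi]
        simp [Am, Pi.single_apply, hdiag]⟩ j
    simp at this
  have hFn : 0 ≤ ∑ i, |f i| := Finset.sum_nonneg fun i _ => abs_nonneg _
  obtain ⟨κ1, hκ1, hκ1a, hκ1b, hκ1c⟩ : ∃ κ1, 0 < κ1 ∧ κ1 ≤ κ ∧ κ1 ≤ 1 ∧ κ1 * ∑ i, |f i| ≤ 1 := by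
    refine ⟨min κ (1 / (1 + ∑ i, |f i|)), lt_min hκ (by positivity), min_le_left _ _, ?_, ?_⟩
    · refine (min_le_right _ _).trans ?_
      rw [div_le_one (by linarith)]; linarith
    · have := min_le_right κ (1 / (1 + ∑ i, |f i|))
      rw [le_div_iff₀ (by linarith)] at this
      have h2 : 0 < min κ (1 / (1 + ∑ i, |f i|)) := lt_min hκ (by positivity)
      nlinarith
  let C : Set (Fin N → ℝ) := {Y | (∀ i, 0 ≤ Y i) ∧ (∀ i, Y i ≤ 3) ∧ (∀ i, i ∉ J → Y i = 0) ∧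
    κ1 * f j ≤ ∑ i, f i * Y i ∧ ∏ i ∈ J, Y i = 0}
  have hCc : IsCompact C := by
    refine IsCompact.of_isClosed_subset (isCompact_Icc (a := (0 : Fin N → ℝ)) (b := fun _ => 3)) ?_
      (fun Y hY => ⟨hY.1, hY.2.1⟩)
    have c1 : IsClosed {Y : Fin N → ℝ | ∀ i, 0 ≤ Y i} := by
      simp only [Set.ofPred_forall]
      exact isClosed_iInter fun i => isClosed_le continuous_const (continuous_apply i)
    have c2 : IsClosed {Y : Fin N → ℝ | ∀ i, Y i ≤ 3} := by
      simp only [Set.ofPred_forall]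
      exact isClosed_iInter fun i => isClosed_le (continuous_apply i) continuous_const
    have c3 : IsClosed {Y : Fin N → ℝ | ∀ i, i ∉ J → Y i = 0} := by
      simp only [Set.ofPred_forall]
      exact isClosed_iInter fun i => isClosed_iInter fun _ =>
          isClosed_eq (continuous_apply i) continuous_const
    have c4 : IsClosed {Y : Fin N → ℝ | κ1 * f j ≤ ∑ i, f i * Y i} :=
      isClosed_le continuous_const (by fun_prop)
    have c5 : IsClosed {Y : Fin N → ℝ | ∏ i ∈ J, Y i = 0} :=
      isClosed_eq (by fun_prop) continuous_const
    exact c1.inter (c2.inter (c3.inter (c4.inter c5)))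
  obtain ⟨σ, hσ, hadv⟩ := uniform_adv (a := a) (J := J) C hCc (fun Y hY => hY.1)
    (fun Y hY => hY.2.2.1) (fun Y hY κ' hκ' => local_adv ha hR hQ IH Y hY.1
      (Finset.prod_eq_zero_iff.1 hY.2.2.2.2) (by
        by_contra hcon
        push Not at hcon
        have h1 : ∑ i, f i * Y i = 0 := Finset.sum_eq_zero fun i _ => by
          by_cases hi : i ∈ J
          · rw [le_antisymm (hcon i hi) (hY.1 i), mul_zero]
          · rw [hfoff i hi, zero_mul]
        have := hY.2.2.2.1
        rw [h1] at this
        nlinarith [mul_pos hκ1 hfj]) κ' hκ') κ1 hκ1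
  let Y0 : Fin N → ℝ := fun i => if i = j then κ1 else 0
  have hY0a : ∀ i, 0 ≤ Y0 i ∧ Y0 i ≤ κ1 := fun i => by
    simp only [Y0]; split_ifs <;> constructor <;> linarith
  have hY0f : ∑ i, f i * Y0 i = κ1 * f j := by simp [Y0, mul_comm]
  have main : ∀ n : ℕ, ∃ Y p c, CPath a J Y0 Y p c ∧ c ≤ κ1 * p ∧ (∃ i ∈ J, Y i = 0) ∧
      (1 ≤ p ∨ n * σ ≤ p) := by
    intro n
    induction n with
    | zero => exact ⟨Y0, 0, 0, CPath.refl, by simp, ⟨j', hj', by simp [Y0, hjj]⟩, by simp⟩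
    | succ n ih =>
      obtain ⟨Y, p, c, hp, hc, hz, h⟩ := ih
      by_cases h1 : 1 ≤ p
      · exact ⟨Y, p, c, hp, hc, hz, Or.inl h1⟩
      have h2 := h.resolve_left h1
      push Not at h1
      have hp0 := hp.p_nonneg
      have hYC : (fun i => if i ∈ J then Y i else 0) ∈ C := by
        refine ⟨fun i => ?_, fun i => ?_, fun i hi => by simp [hi], ?_, ?_⟩
        · show 0 ≤ if i ∈ J then Y i else 0
          split_ifs with hi
          · exact hp.pos (fun i _ => (hY0a i).1) i hi
          · exact le_rfl
        · show (if i ∈ J then Y i else 0) ≤ 3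
          split_ifs with hi
          · have := (abs_le.1 (hp.abs_le ha i)).2
            have := (hY0a i).2
            nlinarith
          · norm_num
        · have e : ∑ i, f i * (if i ∈ J then Y i else 0) = ∑ i, f i * Y i :=
            Finset.sum_congr rfl fun i _ => by
              by_cases hi : i ∈ J
              · simp [hi]
              · simp [hi, hfoff i hi]
          show κ1 * f j ≤ ∑ i, f i * (if i ∈ J then Y i else 0)
          rw [e]
          have := hp.functional f hf
          rw [hY0f] at this
          nlinarith [mul_le_mul_of_nonneg_right hc hFn]
        · obtain ⟨i, hi, hz⟩ := hz
          exact Finset.prod_eq_zero hi (by simp [hz])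
      obtain ⟨Y', p', c', hp', hσ', hc', hz'⟩ := (hadv _ hYC).translate (Y1 := Y)
        (fun i hi => by simp [hi])
      refine ⟨Y', p + p', c + c', hp.trans hp', by linarith, hz', Or.inr ?_⟩
      push_cast
      linarith
  obtain ⟨n, hn⟩ := exists_nat_gt (1 / σ)
  obtain ⟨Y, p, c, hp, hc, ⟨i, hi, hz⟩, h⟩ := main n
  rw [div_lt_iff₀ hσ] at hn
  have hp1 : 1 ≤ p := by rcases h with h | h <;> linarith
  have hpp : 0 < p := by linarith
  have hs := hp.scale (inv_pos.2 hpp)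
  rw [inv_mul_cancel₀ hpp.ne'] at hs
  have hpi : p⁻¹ ≤ 1 := inv_le_one_of_one_le₀ hp1
  refine ⟨_, _, _, hs, ?_, fun i => ⟨mul_nonneg (inv_pos.2 hpp).le (hY0a i).1, ?_⟩, fun i hi' => ?_,
    i, hi, by simp [hz]⟩
  · rw [inv_mul_le_iff₀ hpp]
    nlinarith
  · nlinarith [(hY0a i).1, (hY0a i).2, inv_pos.2 hpp]
  · have : i ≠ j := fun h => hi' (h ▸ hj)
    simp [Y0, this]
/-- Chains of potentials. -/
inductive PotChain {N : ℕ} (a : Fin N → Fin N → ℝ) : (Fin N → ℝ) → (Fin N → ℝ) → Prop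
  | init (φ ψ : Fin N → ℝ) (h1 : ∀ i, 1 ≤ φ i) (h2 : ∀ i, ψ i ≤ -1) : PotChain a φ ψ
  | step {φ ψ : Fin N → ℝ} (z φ' ψ' : Fin N → ℝ) (h : PotChain a φ ψ) (hz : ∀ i, 0 ≤ z i)
      (hφ' : ∀ i, 0 ≤ φ' i)
      (hup : ∀ i, φ i ≤ φ' i + ∑ j, z j * (if j = i then 0 else φ' i - a j i))
      (hlo : ∀ i, ψ' i + ∑ j, z j * (ψ' i - a j i) ≤ ψ i) : PotChain a φ' ψ'

lemma PotChain.seq {N : ℕ} {a : Fin N → Fin N → ℝ} {φ ψ : Fin N → ℝ} (h : PotChain a φ ψ) :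
    ∃ (K : ℕ) (zs φs ψs : ℕ → Fin N → ℝ), (∀ k i, 0 ≤ zs k i) ∧ (∀ k i, 0 ≤ φs k i) ∧
      (∀ i, 1 ≤ φs 0 i) ∧ (∀ i, ψs 0 i ≤ -1) ∧
      (∀ k < K, ∀ i, φs k i ≤ φs (k + 1) i +
        ∑ j, zs k j * (if j = i then 0 else φs (k + 1) i - a j i)) ∧
      (∀ k < K, ∀ i, ψs (k + 1) i + ∑ j, zs k j * (ψs (k + 1) i - a j i) ≤ ψs k i) ∧
      φs K = φ ∧ ψs K = ψ := by
  induction h with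
  | init φ ψ h1 h2 =>
    exact ⟨0, fun _ _ => 0, fun _ => φ, fun _ => ψ, by simp, fun _ i => by linarith [h1 i], h1, h2,
      by simp, by simp, rfl, rfl⟩
  | step z φ' ψ' h hz hφ' hup hlo ih =>
    obtain ⟨K, zs, φs, ψs, a1, a2, a3, a4, a5, a6, a7, a8⟩ := ih
    refine ⟨K + 1, fun k => if k < K then zs k else z, fun k => if k ≤ K then φs k else φ',
      fun k => if k ≤ K then ψs k else ψ', ?_, ?_, by simpa using a3, by simpa using a4, ?_, ?_,
      by simp, by simp⟩
    · intro k i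
      by_cases hk : k < K
      · simpa [hk] using a1 k i
      · simpa [hk] using hz i
    · intro k i
      by_cases hk : k ≤ K
      · simpa [hk] using a2 k i
      · simpa [hk] using hφ' i
    · intro k hk i
      rcases Nat.lt_succ_iff_lt_or_eq.1 hk with hk | hk
      · have h1 : k ≤ K := hk.le
        have h2 : k + 1 ≤ K := hk
        simpa only [hk, h1, h2, if_true] using a5 k hk i
      · subst hk
        have h2 : ¬ (k + 1 ≤ k) := by omega
        simpa only [lt_irrefl, le_refl, h2, if_true, if_false, a7] using hup i
    · intro k hk i
      rcases Nat.lt_succ_iff_lt_or_eq.1 hk with hk | hk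
      · have h1 : k ≤ K := hk.le
        have h2 : k + 1 ≤ K := hk
        simpa only [hk, h1, h2, if_true] using a6 k hk i
      · subst hk
        have h2 : ¬ (k + 1 ≤ k) := by omega
        simpa only [lt_irrefl, le_refl, h2, if_true, if_false, a8] using hlo i

lemma bern_step (b : ℕ) (U P s G G' B : ℝ) (hU : 0 ≤ U) (hP : 0 < P) (hs : 0 ≤ s) (hG : P ≤ G)
    (hG' : G' ≤ G + b * s) (h : U ^ b * G ≤ B) : (U * P / (P + s)) ^ b * G' ≤ B := by
  have hPs : 0 < P + s := by linarith
  have h1 : 1 + b * (s / P) ≤ (1 + s / P) ^ b :=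
    one_add_mul_le_pow (by have := div_nonneg hs hP.le; linarith) b
  have e1 : 1 + s / P = (P + s) / P := by field_simp
  rw [e1, div_pow] at h1
  have hPb : 0 < P ^ b := pow_pos hP b
  have hPsb : 0 < (P + s) ^ b := pow_pos hPs b
  have h2 : P ^ b * (P + b * s) ≤ (P + s) ^ b * P := by
    rw [le_div_iff₀ hPb] at h1
    have h3 := mul_le_mul_of_nonneg_right h1 hP.le
    have e2 : (1 + b * (s / P)) * P ^ b * P = P ^ b * (P + b * s) := by field_simp
    linarith
  have h3 : P ^ b * G' ≤ (P + s) ^ b * G := by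
    have h5 : P ^ b ≤ (P + s) ^ b := pow_le_pow_left₀ hP.le (by linarith) b
    have h6 := mul_le_mul_of_nonneg_left hG' hPb.le
    have h7 := mul_le_mul_of_nonneg_right h5 (sub_nonneg.2 hG)
    nlinarith
  rw [div_pow, mul_pow, div_mul_eq_mul_div, div_le_iff₀ hPsb]
  have hUb : 0 ≤ U ^ b := pow_nonneg hU b
  calc U ^ b * P ^ b * G' = U ^ b * (P ^ b * G') := by ring
    _ ≤ U ^ b * ((P + s) ^ b * G) := mul_le_mul_of_nonneg_left h3 hUb
    _ = (U ^ b * G) * (P + s) ^ b := by ring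
    _ ≤ B * (P + s) ^ b := mul_le_mul_of_nonneg_right h hPsb.le

lemma sum_split_off {N : ℕ} (z : Fin N → ℝ) (i : Fin N) :
    ∑ j, z j = z i + ∑ j ∈ Finset.univ.erase i, z j :=
  (Finset.add_sum_erase _ _ (Finset.mem_univ i)).symm

lemma path_star {N : ℕ} {a : Fin N → Fin N → ℝ} (ha : ∀ j i, |a j i| ≤ 1)
    (hdiag : ∀ i, a i i = 0) {J : Finset (Fin N)} (hne : J.Nonempty)
    (hoff : ∀ j ∈ J, ∀ i, i ∉ J → 0 ≤ a j i) (κ p0 c0 : ℝ) (b : ℕ) (hp0 : 0 < p0)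
    (hκp : κ ≤ p0) (hc0 : 0 < c0) (hb : 1 + 1 / c0 ≤ b) (jj : Fin N → Fin N)
    (hjJ : ∀ i ∈ J, jj i ∈ J) (hja : ∀ i ∈ J, a i (jj i) ≤ -c0)
    {Y0 Y : Fin N → ℝ} {p c : ℝ} (hY0 : ∀ i, 0 ≤ Y0 i ∧ Y0 i ≤ κ)
    (h : CPath a J Y0 Y p c) : c ≤ κ →
    ∃ U : Fin N → ℝ, (∀ i, 0 ≤ U i) ∧ (∀ i, i ∉ J → U i * (p0 + p) = p0) ∧
      (∀ i ∈ J, U i ^ b * (p0 + p + (Y (jj i) + κ - c) / c0) ≤ p0 + 2 * κ / c0) ∧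
      PotChain a (fun i => Y i / (p0 + p) + c / p0 + U i)
        (fun i => Y i / (p0 + p) - c / p0 - 2 * p0 / (p0 + p)) ∧ (∀ i, 0 ≤ Y i) ∧ 0 ≤ c := by
  classical
  induction h with
  | refl =>
    intro _
    refine ⟨fun _ => 1, by simp, by simp, fun i hi => ?_, PotChain.init _ _ (fun i => ?_) (fun i => ?_),
      fun i => (hY0 i).1, le_rfl⟩
    · have h1 := (hY0 (jj i)).2
      have : (Y0 (jj i) + κ - 0) / c0 ≤ 2 * κ / c0 := div_le_div_of_nonneg_right (by linarith) hc0.le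
      simp only [one_pow]; linarith
    · have := div_nonneg (hY0 i).1 hp0.le
      simp; exact this
    · have h1 : Y0 i / p0 ≤ 1 := by rw [div_le_one hp0]; linarith [(hY0 i).2]
      have h2 : 2 * p0 / p0 = 2 := by field_simp
      simp only [add_zero, zero_div, h2]; linarith
  | @step Y p c z e c' Y' hpath hz hzJ he heJ hY hpos hcomp ih =>
    intro hcκ
    have hc' : 0 ≤ c' := by
      obtain ⟨i, _⟩ := hne
      exact (abs_nonneg _).trans (he i)
    obtain ⟨U, hU, hUoff, hUJ, hstar, hYpos, hc⟩ := ih (by linarith)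
    have hp := hpath.p_nonneg
    have hS : 0 ≤ ∑ i, z i := Finset.sum_nonneg fun i _ => hz i
    obtain ⟨P, hPdef⟩ : ∃ P, P = p0 + p := ⟨_, rfl⟩
    obtain ⟨P', hP'def⟩ : ∃ P', P' = P + ∑ i, z i := ⟨_, rfl⟩
    have hP'e : p0 + (p + ∑ i, z i) = P' := by rw [hP'def, hPdef]; ring
    rw [hP'e]
    rw [← hPdef] at hUoff hUJ hstar
    have hP : 0 < P := by linarith
    have hP' : 0 < P' := by linarith
    have hPp : p0 ≤ P := by linarith
    let sm : Fin N → ℝ := fun i => ∑ j ∈ Finset.univ.erase i, z j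
    have hsm : ∀ i, 0 ≤ sm i := fun i => Finset.sum_nonneg fun j _ => hz j
    have hsum : ∀ i, ∑ j, z j = z i + sm i := fun i => sum_split_off z i
    have hY'pos : ∀ i, 0 ≤ Y' i := by
      intro i
      by_cases hi : i ∈ J
      · exact hpos i hi
      · rw [hY, heJ i hi]
        have : 0 ≤ Am a z i := Finset.sum_nonneg fun j _ => by
          by_cases hj : j ∈ J
          · exact mul_nonneg (hz j) (hoff j hj i hi)
          · simp [hzJ j hj]
        linarith [hYpos i]
    have hcompl : ∀ i, z i * Y' i = 0 := fun i => by
      by_cases hi : i ∈ J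
      · exact hcomp i hi
      · simp [hzJ i hi]
    refine ⟨fun i => U i * P / (P + sm i), fun i => ?_, fun i hi => ?_, fun i hi => ?_, ?_,
      hY'pos, by linarith⟩
    · exact div_nonneg (mul_nonneg (hU i) hP.le) (by linarith [hsm i])
    · have h1 : P + sm i = P' := by rw [hP'def, hsum i, hzJ i hi]; ring
      show U i * P / (P + sm i) * P' = p0
      rw [h1, hUoff i hi, div_mul_cancel₀ _ hP'.ne']
    · refine bern_step b (U i) P (sm i) (P + (Y (jj i) + κ - c) / c0) _ _ (hU i) hP (hsm i) ?_ ?_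
        (hUJ i hi)
      · have : 0 ≤ (Y (jj i) + κ - c) / c0 := div_nonneg (by linarith [hYpos (jj i)]) hc0.le
        linarith
      · have h1 : Am a z (jj i) ≤ sm i - c0 * z i := by
          unfold Am
          rw [sum_split_off (fun j => z j * a j (jj i)) i]
          have h2 : ∑ j ∈ Finset.univ.erase i, z j * a j (jj i) ≤ sm i :=
            Finset.sum_le_sum fun j _ =>
              mul_le_of_le_one_right (hz j) ((le_abs_self _).trans (ha j _))
          nlinarith [hja i hi, hz i]
        have h2 := (abs_le.1 (he (jj i))).2
        have h3 : (Y' (jj i) + κ - (c + c')) / c0 ≤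
            (Y (jj i) + κ - c) / c0 + (1 / c0 * sm i - z i) := by
          rw [hY]
          have : (Y (jj i) + κ - c) / c0 + (1 / c0 * sm i - z i) =
              (Y (jj i) + κ - c + sm i - c0 * z i) / c0 := by field_simp; ring
          rw [this]
          exact div_le_div_of_nonneg_right (by linarith) hc0.le
        have h4 : (1 + 1 / c0) * sm i ≤ b * sm i := mul_le_mul_of_nonneg_right hb (hsm i)
        rw [hP'def, hsum i]
        linarith
    · refine hstar.step (fun i => z i / P) _ _ (fun i => div_nonneg (hz i) hP.le) (fun i => ?_)
        (fun i => ?_) (fun i => ?_)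
      · have h1 := div_nonneg (hY'pos i) hP'.le
        have h2 : 0 ≤ (c + c') / p0 := div_nonneg (by linarith) hp0.le
        have h3 : 0 ≤ U i * P / (P + sm i) :=
          div_nonneg (mul_nonneg (hU i) hP.le) (by linarith [hsm i])
        show 0 ≤ Y' i / P' + (c + c') / p0 + U i * P / (P + sm i)
        linarith
      · show Y i / P + c / p0 + U i ≤ _
        obtain ⟨v, hv⟩ : ∃ v, v = Y' i / P' + (c + c') / p0 + U i * P / (P + sm i) := ⟨_, rfl⟩
        rw [← hv]
        have e1 : ∑ j, z j / P * (if j = i then 0 else v - a j i) = (sm i * v - Am a z i) / P := by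
          rw [sum_split_off _ i, if_pos rfl]
          unfold Am
          rw [sum_split_off (fun j => z j * a j i) i, hdiag, Finset.sum_mul, mul_zero, mul_zero,
            zero_add, zero_add, ← Finset.sum_sub_distrib, Finset.sum_div]
          refine Finset.sum_congr rfl fun j hj => ?_
          rw [if_neg (Finset.ne_of_mem_erase hj)]; ring
        rw [e1]
        have hPs : 0 < P + sm i := by linarith [hsm i]
        have e2 : (P + sm i) * v = Y' i + (P + sm i) * ((c + c') / p0) + U i * P := by
          have h1 : P + sm i = P' - z i := by rw [hP'def, hsum i]; ring
          have h2 : (P + sm i) * (Y' i / P') = Y' i := by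
            rw [h1, sub_mul, mul_div_cancel₀ _ hP'.ne']
            have := hcompl i
            rw [← mul_div_assoc, this]; simp
          have h3 : (P + sm i) * (U i * P / (P + sm i)) = U i * P := mul_div_cancel₀ _ hPs.ne'
          rw [hv, mul_add, mul_add, h2, h3]
        have h5 : c' + P * (c / p0) ≤ (P + sm i) * ((c + c') / p0) := by
          have h6 : 0 ≤ c / p0 := div_nonneg hc hp0.le
          have h7 : 0 ≤ c' / p0 := div_nonneg hc' hp0.le
          have h8 : c' = p0 * (c' / p0) := (mul_div_cancel₀ _ hp0.ne').symm
          have h9 := hsm i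
          rw [add_div]
          nlinarith
        have h10 := (abs_le.1 (he i)).1
        have e3 : Y i / P + c / p0 + U i = (Y i + P * (c / p0) + U i * P) / P := by field_simp
        have e4 : v + (sm i * v - Am a z i) / P = ((P + sm i) * v - Am a z i) / P := by
          field_simp; ring
        rw [e3, e4, e2, hY]
        exact div_le_div_of_nonneg_right (by linarith) hP.le
      · show _ ≤ Y i / P - c / p0 - 2 * p0 / P
        obtain ⟨v, hv⟩ : ∃ v, v = Y' i / P' - (c + c') / p0 - 2 * p0 / P' := ⟨_, rfl⟩
        rw [← hv]
        have e1 : ∑ j, z j / P * (v - a j i) = ((∑ j, z j) * v - Am a z i) / P := by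
          unfold Am
          rw [Finset.sum_mul, ← Finset.sum_sub_distrib, Finset.sum_div]
          exact Finset.sum_congr rfl fun j hj => by ring
        rw [e1]
        have e2 : P' * v = Y' i - P' * ((c + c') / p0) - 2 * p0 := by
          rw [hv, mul_sub, mul_sub, mul_div_cancel₀ _ hP'.ne', mul_div_cancel₀ _ hP'.ne']
        have h5 : c' + P * (c / p0) ≤ P' * ((c + c') / p0) := by
          have h6 : 0 ≤ c / p0 := div_nonneg hc hp0.le
          have h7 : 0 ≤ c' / p0 := div_nonneg hc' hp0.le
          have h8 : c' = p0 * (c' / p0) := (mul_div_cancel₀ _ hp0.ne').symm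
          rw [add_div, hP'def]
          nlinarith
        have h10 := (abs_le.1 (he i)).2
        have e3 : Y i / P - c / p0 - 2 * p0 / P = (Y i - P * (c / p0) - 2 * p0) / P := by
          field_simp
        have e4 : v + ((∑ j, z j) * v - Am a z i) / P = (P' * v - Am a z i) / P := by
          rw [hP'def]; field_simp; ring
        rw [e3, e4, e2, hY]
        exact div_le_div_of_nonneg_right (by linarith) hP.le

theorem star_exists {N : ℕ} {a : Fin N → Fin N → ℝ} (ha : ∀ j i, |a j i| ≤ 1)
    (hdiag : ∀ i, a i i = 0) {J : Finset (Fin N)} (hne : J.Nonempty)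
    (hoff : ∀ j ∈ J, ∀ i, i ∉ J → 0 ≤ a j i) (hR : IsR0 a J) (hQ : IsQ a J)
    (ε : ℝ) (hε : 0 < ε) : ∃ φ ψ, PotChain a φ ψ ∧ ∀ i, φ i - ψ i ≤ ε / 2 := by
  classical
  have hneg : ∀ i ∈ J, ∃ j ∈ J, a i j < 0 := by
    intro i hi
    by_contra hcon
    push Not at hcon
    have := hR (Pi.single i 1) ⟨fun l => by by_cases h : l = i <;> [(subst h; simp); simp [h]],
      fun l hl => by
        have : l ≠ i := fun h => hl (h ▸ hi)
        simp [this], fun l hl => by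
        have e : Am a (Pi.single i 1) l = a i l := by simp [Am, Pi.single_apply]
        rw [e]
        refine ⟨by simpa using hcon l hl, ?_⟩
        by_cases h : l = i
        · subst h; simp [hdiag]
        · simp [h]⟩ i
    simp at this
  choose! jj hjJ hja using hneg
  obtain ⟨c0, hc0, hc0b⟩ := exists_small_finset J (fun i => - a i (jj i))
    (fun i hi => by linarith [hja i hi])
  obtain ⟨b, hb⟩ := exists_nat_ge (1 + 1 / c0)
  have hb0 : b ≠ 0 := by
    rintro rfl
    have : 0 < 1 / c0 := by positivity
    rw [Nat.cast_zero] at hb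
    linarith
  obtain ⟨η, hη⟩ : ∃ η, η = ε / 16 := ⟨_, rfl⟩
  have hη0 : 0 < η := by rw [hη]; positivity
  have hηb : 0 < η ^ b := pow_pos hη0 b
  obtain ⟨p0, hp0, hp0a, hp0b⟩ : ∃ p0, 0 < p0 ∧ p0 ≤ η ^ b / 2 ∧ p0 ≤ η :=
    ⟨min (η ^ b / 2) η, lt_min (by positivity) hη0, min_le_left _ _, min_le_right _ _⟩
  obtain ⟨κ, hκ, hκa, hκb, hκc⟩ : ∃ κ, 0 < κ ∧ κ ≤ p0 ∧ κ ≤ p0 * η ∧ κ ≤ c0 * η ^ b / 4 :=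
    ⟨min p0 (min (p0 * η) (c0 * η ^ b / 4)), by positivity, min_le_left _ _,
      (min_le_right _ _).trans (min_le_left _ _), (min_le_right _ _).trans (min_le_right _ _)⟩
  obtain ⟨Y0, Y, c, hpath, hc, hY0, -, -⟩ := pclaim ha hdiag J hne hR hQ κ hκ
  obtain ⟨U, hU, hUoff, hUJ, hstar, hYpos, hc0'⟩ := path_star ha hdiag hne hoff κ p0 c0 b hp0 hκa
    hc0 hb jj hjJ (fun i hi => by linarith [hc0b i hi]) hY0 hpath hc
  refine ⟨_, _, hstar, fun i => ?_⟩
  have hUη : U i ≤ η := by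
    by_cases hi : i ∈ J
    · have h1 := hUJ i hi
      have h2 : 2 * κ / c0 ≤ η ^ b / 2 := by
        rw [div_le_iff₀ hc0]; linarith
      have h3 : 0 ≤ (Y (jj i) + κ - c) / c0 := div_nonneg (by linarith [hYpos (jj i)]) hc0.le
      have h4 : U i ^ b ≤ η ^ b := by
        have : 0 ≤ U i ^ b := pow_nonneg (hU i) b
        nlinarith
      exact le_of_pow_le_pow_left₀ hb0 hη0.le h4
    · have h1 := hUoff i hi
      have := hU i
      nlinarith
  have h5 : c / p0 ≤ η := by
    rw [div_le_iff₀ hp0]; linarith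
  have h6 : 2 * p0 / (p0 + 1) ≤ 2 * η := by
    rw [div_le_iff₀ (by linarith)]; nlinarith
  show Y i / (p0 + 1) + c / p0 + U i - (Y i / (p0 + 1) - c / p0 - 2 * p0 / (p0 + 1)) ≤ ε / 2
  linarith

lemma sum_castLE_eq {N n : ℕ} (hnN : n ≤ N) (f : Fin N → ℝ)
    (hf : ∀ j : Fin N, ¬ (j : ℕ) < n → f j = 0) :
    ∑ j, f j = ∑ k : Fin n, f (Fin.castLE hnN k) := by
  symm
  refine (Finset.sum_map Finset.univ (Fin.castLEEmb hnN) f).symm.trans ?_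
  apply Finset.sum_subset (Finset.subset_univ _)
  intro x _ hx
  apply hf
  intro hlt
  apply hx
  rw [Finset.mem_map]
  exact ⟨⟨x, hlt⟩, Finset.mem_univ _, by ext; rfl⟩

lemma isQ_of_hyp {N n : ℕ} (hnN : n ≤ N) (a : Fin N → Fin N → ℝ)
    (hNT : ¬ ∃ (w : Fin n → ℝ) (z : Fin (n + 1) → ℝ),
        IsLCPSolution n (fun i j => a (Fin.castLE hnN i) (Fin.castLE hnN j)) 0 w z ∧ z 0 < 1)
    (hQ : IsQMatrix n (fun i j => a (Fin.castLE hnN i) (Fin.castLE hnN j))) :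
    IsQ a (Finset.univ.filter (fun i : Fin N => (i : ℕ) < n)) := by
  intro d
  obtain ⟨w, z, h1, h2, h3, h4, h5⟩ := hQ (fun k => d (Fin.castLE hnN k))
  have hz0 : 0 < z 0 := by
    rcases (h2 0).lt_or_eq with h | h
    · exact h
    · exfalso
      apply hNT
      refine ⟨w, z, ⟨h1, h2, h3, ?_, h5⟩, by rw [← h]; norm_num⟩
      intro j
      rw [h4 j, ← h]
      simp
  have key : ∀ k : Fin n, d (Fin.castLE hnN k) +
      Am a (fun i : Fin N => if h : (i : ℕ) < n then z (Fin.succ ⟨i, h⟩) / z 0 else 0)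
        (Fin.castLE hnN k) = w k / z 0 := by
    intro k
    rw [h4 k]
    unfold Am
    rw [sum_castLE_eq hnN _ (by intro j hj; simp [hj])]
    rw [add_div, Finset.sum_div, mul_div_cancel_left₀ _ hz0.ne']
    congr 1
    apply Finset.sum_congr rfl
    intro m _
    simp
    ring
  refine ⟨fun i => if h : (i : ℕ) < n then z (Fin.succ ⟨i, h⟩) / z 0 else 0, ?_, ?_, ?_⟩
  · intro i
    dsimp only
    split_ifs with h
    · exact div_nonneg (h2 _) hz0.le
    · exact le_refl _
  · intro i hi
    have : ¬ (i : ℕ) < n := by simpa using hi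
    simp [this]
  · intro i hi
    have hlt : (i : ℕ) < n := by simpa using hi
    have e : i = Fin.castLE hnN ⟨i, hlt⟩ := by ext; rfl
    have hk := key ⟨i, hlt⟩
    rw [← e] at hk
    rw [hk]
    refine ⟨div_nonneg (h1 _) hz0.le, ?_⟩
    dsimp only
    rw [dif_pos hlt]
    rcases h5 ⟨i, hlt⟩ with h | h
    · rw [h]; simp
    · rw [h]; simp

lemma isR0_of_hyp {N n : ℕ} (hnN : n ≤ N) (a : Fin N → Fin N → ℝ)
    (hNT : ¬ ∃ (w : Fin n → ℝ) (z : Fin (n + 1) → ℝ),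
        IsLCPSolution n (fun i j => a (Fin.castLE hnN i) (Fin.castLE hnN j)) 0 w z ∧ z 0 < 1) :
    IsR0 a (Finset.univ.filter (fun i : Fin N => (i : ℕ) < n)) := by
  intro z hz
  obtain ⟨h1, h2, h3⟩ := hz
  by_contra hcon
  push Not at hcon
  obtain ⟨i0, hi0⟩ := hcon
  have hS : 0 < ∑ j, z j := by
    apply Finset.sum_pos' (fun i _ => h1 i)
    exact ⟨i0, Finset.mem_univ _, lt_of_le_of_ne (h1 i0) (Ne.symm hi0)⟩
  have h2' : ∀ j : Fin N, ¬ (j : ℕ) < n → z j = 0 := fun j hj => h2 j (by simpa using hj)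
  have h3' : ∀ k : Fin n, 0 ≤ Am a z (Fin.castLE hnN k) ∧
      z (Fin.castLE hnN k) * Am a z (Fin.castLE hnN k) = 0 := by
    intro k
    have := h3 (Fin.castLE hnN k) (by simp)
    simpa using this
  obtain ⟨S, hSd⟩ : ∃ S, S = ∑ j, z j := ⟨_, rfl⟩
  rw [← hSd] at hS
  apply hNT
  refine ⟨fun k => Am a z (Fin.castLE hnN k) / S,
    Fin.cons 0 (fun k : Fin n => z (Fin.castLE hnN k) / S), ⟨?_, ?_, ?_, ?_, ?_⟩, by simp⟩
  · intro k
    exact div_nonneg (h3' k).1 hS.le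
  · intro i
    refine Fin.cases ?_ ?_ i
    · simp
    · intro k
      simp only [Fin.cons_succ]
      exact div_nonneg (h1 _) hS.le
  · rw [Fin.sum_univ_succ]
    simp only [Fin.cons_zero, Fin.cons_succ, zero_add]
    rw [← Finset.sum_div, ← sum_castLE_eq hnN z h2', ← hSd, div_self hS.ne']
  · intro k
    simp only [Fin.cons_zero, Fin.cons_succ, zero_mul, zero_add]
    unfold Am
    rw [sum_castLE_eq hnN _ (by intro j hj; simp [h2' j hj]), Finset.sum_div]
    apply Finset.sum_congr rfl
    intro m _
    ring
  · intro k
    simp only [Fin.cons_succ]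
    rcases mul_eq_zero.1 (h3' k).2 with h | h
    · left; rw [h]; simp
    · right; rw [h]; simp

lemma hoff_of_hyp {N n : ℕ} (r : Finset (Fin N) → Fin N → ℝ)
    (hIstar : normalPlayers r = {i : Fin N | (i : ℕ) < n})
    (j : Fin N) (hj : (j : ℕ) < n) (i : Fin N) (hi : ¬ (i : ℕ) < n) : 0 ≤ r {j} i := by
  have hjn : j ∈ normalPlayers r := by rw [hIstar]; exact hj
  have hin : i ∉ normalPlayers r := by rw [hIstar]; exact hi
  have hne : j ≠ i := by rintro rfl; exact hi hj
  by_contra hneg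
  apply hin
  unfold normalPlayers at hjn ⊢
  rw [Set.mem_iInter] at hjn ⊢
  intro l
  induction l with
  | zero => exact Set.mem_univ i
  | succ l ih => exact ⟨ih, j, hjn l, hne, by linarith⟩

/-- **If the set of normal players is nonempty (ordered to be `{0,…,n-1}`), the problem
`LCP(R̂,0)` has no nontrivial solution, and `R̂` is a `Q`-matrix, then for every `ε > 0`
the quitting game has a sunspot `ε`-equilibrium in which at every stage, for every signal
history, at most one player quits with positive probability.** -/
theorem quitting_game_sunspot_equilibrium_of_QMatrix
    (N n : ℕ) (hN : 1 ≤ N) (hn : 1 ≤ n) (hnN : n ≤ N)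
    (r : Finset (Fin N) → Fin N → ℝ)
    (hr : ∀ S i, r S i ∈ Set.Icc (-1 : ℝ) 1)
    (hdiag : ∀ i : Fin N, r {i} i = 0)
    (hIstar : normalPlayers r = {i : Fin N | (i : ℕ) < n})
    (hNT : ¬ ∃ (w : Fin n → ℝ) (z : Fin (n + 1) → ℝ),
        IsLCPSolution n (fun i j => r {Fin.castLE hnN i} (Fin.castLE hnN j)) 0 w z ∧
          z 0 < 1)
    (hQ : IsQMatrix n (fun i j => r {Fin.castLE hnN i} (Fin.castLE hnN j)))
    (ε : ℝ) (hε : 0 < ε) :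
    ∃ ξ : Fin N → SunspotStrategy,
      IsSunspotEpsEquilibrium r ξ ε ∧
        ∀ (t : ℕ) (s : Fin (t + 1) → ℝ) (i j : Fin N),
          0 < ξ i t s → 0 < ξ j t s → i = j := by
  have hJ : ∀ i : Fin N, i ∈ Finset.univ.filter (fun i : Fin N => (i : ℕ) < n) ↔ (i : ℕ) < n := by
    intro i; simp
  obtain ⟨φ, ψ, hP, hgap⟩ := star_exists (a := fun j i => r {j} i)
    (J := Finset.univ.filter (fun i : Fin N => (i : ℕ) < n))
    (fun j i => abs_le.2 ⟨(hr {j} i).1, (hr {j} i).2⟩) hdiag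
    ⟨⟨0, hN⟩, (hJ _).2 hn⟩
    (fun j hj i hi => hoff_of_hyp r hIstar j ((hJ j).1 hj) i (fun h => hi ((hJ i).2 h)))
    (isR0_of_hyp hnN (fun j i => r {j} i) hNT)
    (isQ_of_hyp hnN (fun j i => r {j} i) hNT hQ) ε hε
  obtain ⟨K, zs, φs, ψs, a1, a2, a3, a4, a5, a6, a7, a8⟩ := hP.seq
  exact sunspot_of_star r hr hdiag ε hε K zs φs ψs a1 a2 a3 a4 a5 a6
    (by intro i; rw [a7, a8]; exact hgap i)

end
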